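/- arXiv:2411.14646 — 11 statements merged into one kernel-verified Lean document; each statement's English description precedes it below -/
import Mathlib

section
/- Let α ∈ (0,1/2) and let X₁,…,Xₙ be integrable random variables. Put S = X₁+⋯+Xₙ and t = ex_α(X₁)+⋯+ex_α(Xₙ). Then DQ^ex_α(X₁,…,Xₙ) = (1/α)·E[(S−t)₊]/E[|S−t|], where the right-hand side is interpreted as 0 when E[|S−t|] = 0 (convention 0/0 = 0). -/
open MeasureTheory

variable {Ω : Type*} [MeasurableSpace Ω]

/-- `t` is the `α`-expectile of `X` under `P`:
`(1−α)·E[(X−t)₊] = α·E[(X−t)₋]`. -/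
def IsExpectile (P : Measure Ω) (α : ℝ) (X : Ω → ℝ) (t : ℝ) : Prop :=
  (1 - α) * ∫ ω, max (X ω - t) 0 ∂P = α * ∫ ω, max (t - X ω) 0 ∂P

/-- The expectile-based diversification quotient `DQ^ex_α(X₁,…,Xₙ) = α*/α`, where
`α* = inf {β ∈ (0,1) : ex_β(∑ᵢ Xᵢ) ≤ ∑ᵢ ex_α(Xᵢ)}` with the convention `inf ∅ = 1`
(implemented by adjoining `1` to the set, which does not change a nonempty infimum since
the set, when nonempty, has infimum at most `1`). Here `ex` is the expectile functional. -/
noncomputable def DQex (P : Measure Ω) (ex : ℝ → (Ω → ℝ) → ℝ) (α : ℝ)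
    {n : ℕ} (X : Fin n → Ω → ℝ) : ℝ :=
  sInf ({β : ℝ | β ∈ Set.Ioo (0:ℝ) 1 ∧
      ex β (fun ω => ∑ i, X i ω) ≤ ∑ i, ex α (X i)} ∪ {1}) / α

lemma expectile_le_iff (P : Measure Ω) [IsProbabilityMeasure P] (β : ℝ)
    (hβ : β ∈ Set.Ioo (0:ℝ) 1) (S : Ω → ℝ) (hS : Integrable S P) (e t : ℝ)
    (he : IsExpectile P β S e) :
    e ≤ t ↔ ∫ ω, max (S ω - t) 0 ∂P ≤ β * ∫ ω, |S ω - t| ∂P := by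
  have iA : ∀ s : ℝ, Integrable (fun ω => max (S ω - s) 0) P := fun s =>
    (hS.sub (integrable_const s)).pos_part
  have iB : ∀ s : ℝ, Integrable (fun ω => max (s - S ω) 0) P := fun s =>
    ((integrable_const s).sub hS).pos_part
  have hA : ∀ s u : ℝ, s ≤ u → ∫ ω, max (S ω - u) 0 ∂P ≤ ∫ ω, max (S ω - s) 0 ∂P :=
    fun s u h => integral_mono (iA u) (iA s) fun ω => max_le_max (by linarith) le_rfl
  have hB : ∀ s u : ℝ, s ≤ u → ∫ ω, max (s - S ω) 0 ∂P ≤ ∫ ω, max (u - S ω) 0 ∂P :=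
    fun s u h => integral_mono (iB s) (iB u) fun ω => max_le_max (by linarith) le_rfl
  have hD : ∀ s : ℝ, ∫ ω, max (S ω - s) 0 ∂P - ∫ ω, max (s - S ω) 0 ∂P = ∫ ω, S ω ∂P - s := by
    intro s
    rw [← integral_sub (iA s) (iB s)]
    have h : ∀ ω, max (S ω - s) 0 - max (s - S ω) 0 = S ω - s := by
      intro ω
      rcases le_total (S ω) s with h | h
      · rw [max_eq_right (by linarith), max_eq_left (by linarith)]; ring
      · rw [max_eq_left (by linarith), max_eq_right (by linarith)]; ring
    simp_rw [h]
    rw [integral_sub hS (integrable_const s)]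
    simp
  have habs : ∫ ω, |S ω - t| ∂P = ∫ ω, max (S ω - t) 0 ∂P + ∫ ω, max (t - S ω) 0 ∂P := by
    rw [← integral_add (iA t) (iB t)]
    congr 1
    ext ω
    rcases le_total (S ω) t with h | h
    · rw [max_eq_right (by linarith), max_eq_left (by linarith), abs_of_nonpos (by linarith)]; ring
    · rw [max_eq_left (by linarith), max_eq_right (by linarith), abs_of_nonneg (by linarith)]; ring
  rw [habs]
  unfold IsExpectile at he
  obtain ⟨h0, h1⟩ := hβ
  constructor
  · intro h
    nlinarith [hA e t h, hB e t h]
  · intro h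
    by_contra! hlt
    have a := hA t e hlt.le
    have b := hB t e hlt.le
    have d1 := hD t
    have d2 := hD e
    have p := mul_le_mul_of_nonneg_left a (sub_pos.2 h1).le
    have q := mul_le_mul_of_nonneg_left b h0.le
    have p2 := le_of_mul_le_mul_left (a := 1 - β) (b := ∫ ω, max (S ω - t) 0 ∂P)
      (c := ∫ ω, max (S ω - e) 0 ∂P) (by linarith) (sub_pos.2 h1)
    have q2 := le_of_mul_le_mul_left (a := β) (b := ∫ ω, max (e - S ω) 0 ∂P)
      (c := ∫ ω, max (t - S ω) 0 ∂P) (by linarith) h0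
    linarith

/-- For α ∈ (0,1/2) and integrable X₁,…,Xₙ, with S = ∑ᵢ Xᵢ and
t = ∑ᵢ ex_α(Xᵢ), one has DQ^ex_α(X) = (1/α)·E[(S−t)₊]/E[|S−t|], with the convention
0/0 = 0 (which is Lean's convention for division by zero). -/
theorem stmt0
    (P : Measure Ω) [IsProbabilityMeasure P]
    (α : ℝ) (hα : α ∈ Set.Ioo (0:ℝ) (1/2))
    {n : ℕ} (X : Fin n → Ω → ℝ) (hX : ∀ i, Integrable (X i) P)
    (ex : ℝ → (Ω → ℝ) → ℝ)
    (hex : ∀ β ∈ Set.Ioo (0:ℝ) 1, ∀ Y : Ω → ℝ, Integrable Y P → IsExpectile P β Y (ex β Y)) :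
    DQex P ex α X =
      (∫ ω, max ((∑ i, X i ω) - ∑ i, ex α (X i)) 0 ∂P) /
        (α * ∫ ω, |(∑ i, X i ω) - ∑ i, ex α (X i)| ∂P) := by
  have hS : Integrable (fun ω => ∑ i, X i ω) P := integrable_finsetSum _ fun i _ => hX i
  obtain ⟨h0, h1⟩ := hα
  unfold DQex
  set t := ∑ i, ex α (X i) with ht
  have key : ∀ β ∈ Set.Ioo (0:ℝ) 1, (ex β (fun ω => ∑ i, X i ω) ≤ t ↔
      ∫ ω, max ((∑ i, X i ω) - t) 0 ∂P ≤ β * ∫ ω, |(∑ i, X i ω) - t| ∂P) := fun β hβ =>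
    expectile_le_iff P β hβ _ hS _ t (hex β hβ _ hS)
  have hA0 : 0 ≤ ∫ ω, max ((∑ i, X i ω) - t) 0 ∂P :=
    integral_nonneg fun ω => le_max_right _ _
  have hAC : ∫ ω, max ((∑ i, X i ω) - t) 0 ∂P ≤ ∫ ω, |(∑ i, X i ω) - t| ∂P :=
    integral_mono (hS.sub (integrable_const t)).pos_part (hS.sub (integrable_const t)).abs
      fun ω => max_le (le_abs_self _) (abs_nonneg _)
  generalize (∫ ω, max ((∑ i, X i ω) - t) 0 ∂P) = A at *
  generalize (∫ ω, |(∑ i, X i ω) - t| ∂P) = C at *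
  rw [mul_comm α C, ← div_div]
  congr 1
  have hr0 : 0 ≤ A / C := div_nonneg hA0 (hA0.trans hAC)
  have hr1 : A / C ≤ 1 := div_le_one_of_le₀ hAC (hA0.trans hAC)
  have hC : 0 ≤ C := hA0.trans hAC
  refine IsGLB.csInf_eq ⟨?_, ?_⟩ ⟨1, Or.inr rfl⟩
  · rintro β (⟨hβ, h⟩ | h)
    · rw [key β hβ] at h
      exact div_le_of_le_mul₀ hC hβ.1.le h
    · rw [Set.mem_singleton_iff.1 h]; exact hr1
  · intro b hb
    by_contra! hlt
    have hb1 : b ≤ 1 := hb (Or.inr rfl)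
    have hm : (A / C + b) / 2 ∈ Set.Ioo (0:ℝ) 1 := ⟨by linarith, by linarith⟩
    have hle : A ≤ (A / C + b) / 2 * C := by
      rcases hC.eq_or_lt with h | h
      · rw [← h]; linarith
      · rw [← div_le_iff₀ h]; linarith
    have := hb (Or.inl ⟨hm, (key _ hm).2 hle⟩)
    linarith
end

section
/- Let (Ω, 𝓕, P) be an atomless probability space, let n ≥ 2 and α ∈ (0,1/2). Then the set of attained values {DQ^ex_α(X₁,…,Xₙ) : X₁,…,Xₙ integrable random variables} is exactly the interval [0,1]; that is, DQ^ex_α(X₁,…,Xₙ) ∈ [0,1] for all integrable X₁,…,Xₙ, and for every v ∈ [0,1] there exist integrable X₁,…,Xₙ with DQ^ex_α(X₁,…,Xₙ) = v. -/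
open MeasureTheory

variable {Ω : Type*} [MeasurableSpace Ω]

/-- A measure is atomless if every measurable set of positive measure has a measurable
subset of strictly intermediate measure. -/
def Atomless (P : Measure Ω) : Prop :=
  ∀ A : Set Ω, MeasurableSet A → 0 < P A →
    ∃ B : Set Ω, MeasurableSet B ∧ B ⊆ A ∧ 0 < P B ∧ P B < P A



/-- The expectile score. -/
noncomputable def exG (P : Measure Ω) (γ : ℝ) (Y : Ω → ℝ) (t : ℝ) : ℝ :=
  ∫ ω, ((1 - γ) * max (Y ω - t) 0 - γ * max (t - Y ω) 0) ∂P

lemma exG_int (P : Measure Ω) [IsProbabilityMeasure P] (γ : ℝ) (Y : Ω → ℝ) (hY : Integrable Y P)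
    (t : ℝ) : Integrable (fun ω => (1 - γ) * max (Y ω - t) 0 - γ * max (t - Y ω) 0) P := by
  have h1 : Integrable (fun ω => Y ω - t) P := hY.sub (integrable_const t)
  have h2 : Integrable (fun ω => t - Y ω) P := (integrable_const t).sub hY
  exact (h1.pos_part.const_mul _).sub (h2.pos_part.const_mul _)

lemma exG_eq (P : Measure Ω) [IsProbabilityMeasure P] (γ : ℝ) (Y : Ω → ℝ) (hY : Integrable Y P)
    (t : ℝ) : IsExpectile P γ Y t ↔ exG P γ Y t = 0 := by
  have h1 : Integrable (fun ω => Y ω - t) P := hY.sub (integrable_const t)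
  have h2 : Integrable (fun ω => t - Y ω) P := (integrable_const t).sub hY
  unfold exG IsExpectile
  rw [integral_sub (h1.pos_part.const_mul _) (h2.pos_part.const_mul _),
    integral_const_mul, integral_const_mul, sub_eq_zero]

lemma exG_strict (P : Measure Ω) [IsProbabilityMeasure P] (γ : ℝ) (hγ : γ ∈ Set.Ioo (0:ℝ) 1)
    (Y : Ω → ℝ) (hY : Integrable Y P) (s t : ℝ) (hst : s < t) : exG P γ Y t < exG P γ Y s := by
  obtain ⟨h0, h1⟩ := hγ
  have hm : 0 < min γ (1 - γ) := lt_min h0 (by linarith)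
  have key : exG P γ Y t + min γ (1 - γ) * (t - s) ≤ exG P γ Y s := by
    have : exG P γ Y t + min γ (1 - γ) * (t - s)
        = ∫ ω, (((1 - γ) * max (Y ω - t) 0 - γ * max (t - Y ω) 0)
            + min γ (1 - γ) * (t - s)) ∂P := by
      rw [integral_add (exG_int P γ Y hY t) (integrable_const _)]
      simp [exG]
    rw [this]
    refine integral_mono ((exG_int P γ Y hY t).add (integrable_const _)) (exG_int P γ Y hY s) ?_
    intro ω
    have ha := min_le_left γ (1 - γ)
    have hb := min_le_right γ (1 - γ)
    generalize min γ (1 - γ) = m at *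
    simp only
    generalize Y ω = y
    rcases le_total y s with hs | hs
    · rw [max_eq_right (by linarith : y - t ≤ 0), max_eq_left (by linarith : 0 ≤ t - y),
        max_eq_right (by linarith : y - s ≤ 0), max_eq_left (by linarith : 0 ≤ s - y)]
      nlinarith
    · rcases le_total y t with ht | ht
      · rw [max_eq_right (by linarith : y - t ≤ 0), max_eq_left (by linarith : 0 ≤ t - y),
          max_eq_left (by linarith : 0 ≤ y - s), max_eq_right (by linarith : s - y ≤ 0)]
        nlinarith
      · rw [max_eq_left (by linarith : 0 ≤ y - t), max_eq_right (by linarith : t - y ≤ 0),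
          max_eq_left (by linarith : 0 ≤ y - s), max_eq_right (by linarith : s - y ≤ 0)]
        nlinarith
  nlinarith [mul_pos hm (sub_pos.2 hst)]

lemma ex_le_iff (P : Measure Ω) [IsProbabilityMeasure P] (γ : ℝ) (hγ : γ ∈ Set.Ioo (0:ℝ) 1)
    (Y : Ω → ℝ) (hY : Integrable Y P) (e t : ℝ) (he : IsExpectile P γ Y e) :
    e ≤ t ↔ exG P γ Y t ≤ 0 := by
  rw [exG_eq P γ Y hY] at he
  constructor
  · intro h
    rcases h.eq_or_lt with h | h
    · rw [← h, he]
    · exact (he ▸ exG_strict P γ hγ Y hY _ _ h).le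
  · intro h
    by_contra hc
    have := exG_strict P γ hγ Y hY _ _ (not_le.1 hc)
    linarith

lemma ex_unique (P : Measure Ω) [IsProbabilityMeasure P] (γ : ℝ) (hγ : γ ∈ Set.Ioo (0:ℝ) 1)
    (Y : Ω → ℝ) (hY : Integrable Y P) (e t : ℝ) (he : IsExpectile P γ Y e)
    (ht : IsExpectile P γ Y t) : e = t := by
  apply le_antisymm
  · exact (ex_le_iff P γ hγ Y hY e t he).2 ((exG_eq P γ Y hY t).1 ht).le
  · exact (ex_le_iff P γ hγ Y hY t e ht).2 ((exG_eq P γ Y hY e).1 he).le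

lemma phi_eq (a : ℝ) (ha : a ≤ 1/2) (y t : ℝ) :
    (1 - a) * max (y - t) 0 - a * max (t - y) 0 = max ((1 - a) * (y - t)) (a * (y - t)) := by
  rcases le_total y t with h | h
  · rw [max_eq_right (by linarith : y - t ≤ 0), max_eq_left (by linarith : 0 ≤ t - y),
      max_eq_right (by nlinarith)]
    ring
  · rw [max_eq_left (by linarith : 0 ≤ y - t), max_eq_right (by linarith : t - y ≤ 0),
      max_eq_left (by nlinarith)]
    ring

lemma exG_sub (P : Measure Ω) [IsProbabilityMeasure P] (a : ℝ) (ha : a ≤ 1/2) {n : ℕ}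
    (X : Fin n → Ω → ℝ) (hX : ∀ i, Integrable (X i) P) (e : Fin n → ℝ) :
    exG P a (fun ω => ∑ i, X i ω) (∑ i, e i) ≤ ∑ i, exG P a (X i) (e i) := by
  unfold exG
  rw [← integral_finsetSum _ (fun i _ => exG_int P a (X i) (hX i) (e i))]
  refine integral_mono (exG_int P a _ (integrable_finsetSum _ (fun i _ => hX i)) _)
    (integrable_finsetSum _ (fun i _ => exG_int P a (X i) (hX i) (e i))) ?_
  intro ω
  simp only [phi_eq a ha]
  rw [← Finset.sum_sub_distrib, Finset.mul_sum, Finset.mul_sum]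
  exact max_le (Finset.sum_le_sum fun i _ => le_max_left _ _)
    (Finset.sum_le_sum fun i _ => le_max_right _ _)

open Classical in
/-- Two-valued random variable. -/
noncomputable def twoVal (A : Set Ω) (a b : ℝ) : Ω → ℝ := fun ω => if ω ∈ A then a else b

lemma twoVal_int (P : Measure Ω) [IsProbabilityMeasure P] (A : Set Ω) (hA : MeasurableSet A)
    (a b : ℝ) : Integrable (twoVal A a b) P := by
  classical
  have : twoVal A a b = A.piecewise (fun _ => a) (fun _ => b) := rfl
  rw [this]
  exact Integrable.piecewise hA (integrable_const a).integrableOn (integrable_const b).integrableOn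

lemma exG_twoVal (P : Measure Ω) [IsProbabilityMeasure P] (A : Set Ω) (hA : MeasurableSet A)
    (γ a b : ℝ) : exG P γ (twoVal A a b) 0 =
      P.real A * ((1 - γ) * max a 0 - γ * max (-a) 0)
      + (1 - P.real A) * ((1 - γ) * max b 0 - γ * max (-b) 0) := by
  unfold exG
  rw [← integral_add_compl hA (exG_int P γ _ (twoVal_int P A hA a b) 0)]
  congr 1
  · rw [setIntegral_congr_fun hA
      (g := fun _ => (1 - γ) * max a 0 - γ * max (-a) 0)]
    · simp
    · intro ω hω
      simp [twoVal, hω]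
  · rw [setIntegral_congr_fun hA.compl
      (g := fun _ => (1 - γ) * max b 0 - γ * max (-b) 0)]
    · rw [setIntegral_const, probReal_compl_eq_one_sub hA, smul_eq_mul]
    · intro ω hω
      have : ω ∉ A := hω
      simp [twoVal, this]

/-- on an atomless probability space, for n ≥ 2 and α ∈ (0,1/2),
the range of DQ^ex_α over integrable random vectors is exactly the interval [0,1]. -/
theorem stmt2
    (P : Measure Ω) [IsProbabilityMeasure P] (hPa : Atomless P)
    (n : ℕ) (hn : 2 ≤ n)
    (α : ℝ) (hα : α ∈ Set.Ioo (0:ℝ) (1/2))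
    (ex : ℝ → (Ω → ℝ) → ℝ)
    (hex : ∀ β ∈ Set.Ioo (0:ℝ) 1, ∀ Y : Ω → ℝ, Integrable Y P → IsExpectile P β Y (ex β Y)) :
    (∀ X : Fin n → Ω → ℝ, (∀ i, Integrable (X i) P) →
        DQex P ex α X ∈ Set.Icc (0:ℝ) 1) ∧
    (∀ v ∈ Set.Icc (0:ℝ) 1, ∃ X : Fin n → Ω → ℝ,
        (∀ i, Integrable (X i) P) ∧ DQex P ex α X = v) := by
  obtain ⟨ha0, ha1⟩ := hα
  have hα' : α ∈ Set.Ioo (0:ℝ) 1 := ⟨ha0, by linarith⟩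
  constructor
  · intro X hX
    have hmem : α ∈ ({β : ℝ | β ∈ Set.Ioo (0:ℝ) 1 ∧
        ex β (fun ω => ∑ i, X i ω) ≤ ∑ i, ex α (X i)} ∪ {1}) := by
      left
      refine ⟨hα', ?_⟩
      have hS : Integrable (fun ω => ∑ i, X i ω) P := integrable_finsetSum _ (fun i _ => hX i)
      rw [ex_le_iff P α hα' _ hS _ _ (hex α hα' _ hS)]
      refine (exG_sub P α ha1.le X hX _).trans (le_of_eq ?_)
      exact Finset.sum_eq_zero fun i _ => (exG_eq P α _ (hX i) _).1 (hex α hα' _ (hX i))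
    have hlb : ∀ β ∈ ({β : ℝ | β ∈ Set.Ioo (0:ℝ) 1 ∧
        ex β (fun ω => ∑ i, X i ω) ≤ ∑ i, ex α (X i)} ∪ {1}), 0 ≤ β := by
      rintro β (h | h)
      · exact h.1.1.le
      · rw [Set.mem_singleton_iff.1 h]; norm_num
    unfold DQex
    constructor
    · exact div_nonneg (Real.sInf_nonneg hlb) ha0.le
    · rw [div_le_one ha0]
      exact csInf_le ⟨0, hlb⟩ hmem
  · rintro v ⟨hv0, hv1⟩
    obtain ⟨A, hA, -, hA0, hA1⟩ := hPa Set.univ MeasurableSet.univ (by simp)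
    have hp0 : 0 < P.real A := ENNReal.toReal_pos hA0.ne' (measure_ne_top P A)
    have hp1 : P.real A < 1 := by
      rw [measure_univ] at hA1
      have := (ENNReal.toReal_lt_toReal (measure_ne_top P A) ENNReal.one_ne_top).2 hA1
      simpa [Measure.real] using this
    have hG := exG_twoVal P A hA
    have hI := twoVal_int P A hA
    generalize P.real A = p at *
    obtain ⟨b, hb⟩ : ∃ b, b = v * α := ⟨_, rfl⟩
    have hb0 : 0 ≤ b := by rw [hb]; positivity
    have hb1 : b ≤ α := by rw [hb]; nlinarith
    obtain ⟨m, rfl⟩ : ∃ m, n = m + 2 := ⟨n - 2, by omega⟩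
    have hd : 0 < 1 - α - b := by linarith
    obtain ⟨c, hc⟩ : ∃ c, c = (α - b) / (1 - α - b) := ⟨_, rfl⟩
    have hc0 : 0 ≤ c := by rw [hc]; exact div_nonneg (by linarith) hd.le
    obtain ⟨k, hk⟩ : ∃ k, k = (1 - 2 * α) / (1 - α - b) := ⟨_, rfl⟩
    have hk0 : 0 < k := by rw [hk]; exact div_pos (by linarith) hd
    have hq0 : 0 < 1 - p := by linarith
    have hna : 0 < 1 - α := by linarith
    obtain ⟨Y₁, hY₁⟩ : ∃ Y, Y = twoVal A (α * (1 - p)) (-((1 - α) * p)) := ⟨_, rfl⟩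
    obtain ⟨Y₂, hY₂⟩ : ∃ Y, Y = twoVal A (-(c * ((1 - α) * (1 - p)))) (c * (α * p)) := ⟨_, rfl⟩
    have i1 : Integrable Y₁ P := hY₁ ▸ hI _ _
    have i2 : Integrable Y₂ P := hY₂ ▸ hI _ _
    have i3 : Integrable (fun _ : Ω => (0:ℝ)) P := integrable_const 0
    have e1 : ex α Y₁ = 0 := by
      refine ex_unique P α hα' _ i1 _ _ (hex α hα' _ i1) ((exG_eq P α _ i1 0).2 ?_)
      have t1 : 0 < α * (1 - p) := by positivity
      have t2 : 0 < (1 - α) * p := by positivity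
      rw [hY₁, hG, max_eq_left t1.le, max_eq_right (by linarith), max_eq_right (by linarith),
        max_eq_left (by linarith)]
      ring
    have e2 : ex α Y₂ = 0 := by
      refine ex_unique P α hα' _ i2 _ _ (hex α hα' _ i2) ((exG_eq P α _ i2 0).2 ?_)
      have t1 : 0 ≤ c * ((1 - α) * (1 - p)) := by positivity
      have t2 : 0 ≤ c * (α * p) := by positivity
      rw [hY₂, hG, max_eq_left t2,
        max_eq_right (by linarith : -(c * ((1 - α) * (1 - p))) ≤ 0),
        max_eq_left (by linarith : 0 ≤ - -(c * ((1 - α) * (1 - p)))),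
        max_eq_right (by linarith : -(c * (α * p)) ≤ 0)]
      ring
    have e3 : ex α (fun _ => 0) = 0 := by
      refine ex_unique P α hα' _ i3 _ _ (hex α hα' _ i3) ((exG_eq P α _ i3 0).2 ?_)
      simp [exG]
    refine ⟨Fin.cons Y₁ (Fin.cons Y₂ (fun _ _ => 0)), ?_, ?_⟩
    · intro i
      refine Fin.cases ?_ (fun j => ?_) i
      · simpa using i1
      · refine Fin.cases ?_ (fun j => ?_) j
        · simpa using i2
        · simp
    · unfold DQex
      have hsum : (fun ω => ∑ i, (Fin.cons Y₁ (Fin.cons Y₂ (fun _ _ => 0)) :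
          Fin (m + 2) → Ω → ℝ) i ω)
          = twoVal A (k * (b * (1 - p))) (-(k * ((1 - b) * p))) := by
        funext ω
        simp only [Fin.sum_univ_succ, Fin.cons_zero, Fin.cons_succ, Finset.sum_const_zero, add_zero]
        rw [hY₁, hY₂, hk, hc]
        unfold twoVal
        split_ifs
        · field_simp
          ring
        · field_simp
          ring
      have hes : ∑ i, ex α ((Fin.cons Y₁ (Fin.cons Y₂ (fun _ _ => 0)) :
          Fin (m + 2) → Ω → ℝ) i) = 0 := by
        simp [Fin.sum_univ_succ, e1, e2, e3]
      rw [hsum, hes]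
      have hiff : ∀ γ ∈ Set.Ioo (0:ℝ) 1,
          (ex γ (twoVal A (k * (b * (1 - p))) (-(k * ((1 - b) * p)))) ≤ 0 ↔ b ≤ γ) := by
        intro γ hγ
        rw [ex_le_iff P γ hγ _ (hI _ _) _ _ (hex γ hγ _ (hI _ _)), hG]
        have t1 : 0 ≤ k * (b * (1 - p)) := by positivity
        have hb2 : 0 < 1 - b := by linarith
        have t2 : 0 ≤ k * ((1 - b) * p) := by positivity
        rw [max_eq_left t1, max_eq_right (by linarith), max_eq_right (by linarith),
          max_eq_left (by linarith)]
        have hpos : 0 < k * p * (1 - p) := by positivity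
        have : p * ((1 - γ) * (k * (b * (1 - p))) - γ * 0)
            + (1 - p) * ((1 - γ) * 0 - γ * - -(k * ((1 - b) * p)))
            = (k * p * (1 - p)) * (b - γ) := by ring
        rw [this]
        constructor
        · intro h
          by_contra hcon
          nlinarith [mul_pos hpos (sub_pos.2 (not_le.1 hcon))]
        · intro h
          exact mul_nonpos_of_nonneg_of_nonpos hpos.le (by linarith)
      have hglb : IsGLB ({β : ℝ | β ∈ Set.Ioo (0:ℝ) 1 ∧
          ex β (twoVal A (k * (b * (1 - p))) (-(k * ((1 - b) * p)))) ≤ 0} ∪ {1}) b := by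
        constructor
        · rintro β (h | h)
          · exact (hiff β h.1).1 h.2
          · rw [Set.mem_singleton_iff.1 h]; linarith
        · intro l hl
          by_contra hcon
          rw [not_le] at hcon
          obtain ⟨w, hw1, hw2⟩ := exists_between (lt_min hcon (by linarith : b < 1))
          have hw3 := lt_min_iff.1 hw2
          have hw4 : w ∈ Set.Ioo (0:ℝ) 1 := ⟨by linarith, hw3.2⟩
          have := hl (Or.inl ⟨hw4, (hiff w hw4).2 hw1.le⟩)
          linarith [hw3.1]
      rw [hglb.csInf_eq ⟨1, Or.inr rfl⟩, hb]
      field_simp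
end

section
/- Let α ∈ (0,1/2) and let X₁,…,Xₙ be integrable random variables. Then DQ^ex_α(X₁,…,Xₙ) = 0 if and only if X₁+⋯+Xₙ ≤ ex_α(X₁)+⋯+ex_α(Xₙ) P-almost surely. In particular, if X₁+⋯+Xₙ is P-almost surely constant, then DQ^ex_α(X₁,…,Xₙ) = 0. -/
open MeasureTheory

variable {Ω : Type*} [MeasurableSpace Ω]

theorem aux_int_pos {P : Measure Ω} [IsProbabilityMeasure P] {Y : Ω → ℝ}
    (hY : Integrable Y P) (t : ℝ) : Integrable (fun ω => max (Y ω - t) 0) P :=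
  (hY.sub (integrable_const t)).pos_part

theorem aux_int_neg {P : Measure Ω} [IsProbabilityMeasure P] {Y : Ω → ℝ}
    (hY : Integrable Y P) (t : ℝ) : Integrable (fun ω => max (t - Y ω) 0) P :=
  ((integrable_const t).sub hY).pos_part

/-- For `α < 1/2` the expectile dominates the mean. -/
theorem aux_mean_le {P : Measure Ω} [IsProbabilityMeasure P] {Y : Ω → ℝ}
    (hY : Integrable Y P) {α t : ℝ} (hα : α ∈ Set.Ioo (0:ℝ) (1/2))
    (h : IsExpectile P α Y t) : ∫ ω, Y ω ∂P ≤ t := by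
  unfold IsExpectile at h
  have hA : 0 ≤ ∫ ω, max (Y ω - t) 0 ∂P := integral_nonneg fun ω => le_max_right _ _
  have hB : 0 ≤ ∫ ω, max (t - Y ω) 0 ∂P := integral_nonneg fun ω => le_max_right _ _
  have hd : ∫ ω, max (Y ω - t) 0 ∂P - ∫ ω, max (t - Y ω) 0 ∂P = ∫ ω, Y ω ∂P - t := by
    rw [← integral_sub (aux_int_pos hY t) (aux_int_neg hY t)]
    have : ∀ ω, max (Y ω - t) 0 - max (t - Y ω) 0 = Y ω - t := by
      intro ω
      rcases le_total (Y ω) t with h | h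
      · rw [max_eq_right (by linarith), max_eq_left (by linarith)]; ring
      · rw [max_eq_left (by linarith), max_eq_right (by linarith)]; ring
    simp only [this]
    rw [integral_sub hY (integrable_const t)]
    simp
  obtain ⟨h0, h1⟩ := hα
  nlinarith

/-- An almost sure upper bound of `Y` bounds every expectile of `Y`. -/
theorem aux_le_of_ae {P : Measure Ω} [IsProbabilityMeasure P] {Y : Ω → ℝ}
    (hY : Integrable Y P) {β s t : ℝ} (hβ : β ∈ Set.Ioo (0:ℝ) 1)
    (h : IsExpectile P β Y s) (hle : ∀ᵐ ω ∂P, Y ω ≤ t) : s ≤ t := by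
  by_contra! hst
  unfold IsExpectile at h
  have hA : ∫ ω, max (Y ω - s) 0 ∂P = 0 := by
    apply integral_eq_zero_of_ae
    filter_upwards [hle] with ω hω
    exact max_eq_right (by linarith)
  have hB : s - t ≤ ∫ ω, max (s - Y ω) 0 ∂P := by
    have : ∫ _ω, (s - t) ∂P ≤ ∫ ω, max (s - Y ω) 0 ∂P := by
      apply integral_mono_ae (integrable_const _) (aux_int_neg hY s)
      filter_upwards [hle] with ω hω
      exact le_max_of_le_left (by linarith)
    simpa using this
  rw [hA, mul_zero] at h
  have := mul_pos hβ.1 (lt_of_lt_of_le (sub_pos.2 hst) hB)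
  linarith

/-- DQ^ex_α(X) = 0 iff ∑ᵢ Xᵢ ≤ ∑ᵢ ex_α(Xᵢ) a.s.; in particular the
DQ vanishes when the total loss is a.s. constant. -/
theorem stmt3
    (P : Measure Ω) [IsProbabilityMeasure P]
    (α : ℝ) (hα : α ∈ Set.Ioo (0:ℝ) (1/2))
    {n : ℕ} (X : Fin n → Ω → ℝ) (hX : ∀ i, Integrable (X i) P)
    (ex : ℝ → (Ω → ℝ) → ℝ)
    (hex : ∀ β ∈ Set.Ioo (0:ℝ) 1, ∀ Y : Ω → ℝ, Integrable Y P → IsExpectile P β Y (ex β Y)) :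
    (DQex P ex α X = 0 ↔ ∀ᵐ ω ∂P, (∑ i, X i ω) ≤ ∑ i, ex α (X i)) ∧
    ((∃ c : ℝ, ∀ᵐ ω ∂P, (∑ i, X i ω) = c) → DQex P ex α X = 0) := by
  set S : Ω → ℝ := fun ω => ∑ i, X i ω with hS
  set t : ℝ := ∑ i, ex α (X i) with ht
  have hSint : Integrable S P := integrable_finsetSum _ fun i _ => hX i
  have hα0 : α ≠ 0 := hα.1.ne'
  have hbdd : BddBelow ({β : ℝ | β ∈ Set.Ioo (0:ℝ) 1 ∧ ex β S ≤ t} ∪ {1}) := by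
    refine ⟨0, ?_⟩
    rintro β (hβ | hβ)
    · exact hβ.1.1.le
    · rw [Set.mem_singleton_iff] at hβ
      rw [hβ]; exact zero_le_one
  have hiff : DQex P ex α X = 0 ↔ ∀ᵐ ω ∂P, S ω ≤ t := by
    have h1 : DQex P ex α X = 0 ↔
        sInf ({β : ℝ | β ∈ Set.Ioo (0:ℝ) 1 ∧ ex β S ≤ t} ∪ {1}) = 0 := by
      unfold DQex
      rw [div_eq_zero_iff]
      simp only [hα0, or_false]
      rfl
    rw [h1]
    constructor
    · intro h0
      have hA : 0 ≤ ∫ ω, max (S ω - t) 0 ∂P := integral_nonneg fun ω => le_max_right _ _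
      have hB : 0 ≤ ∫ ω, max (t - S ω) 0 ∂P := integral_nonneg fun ω => le_max_right _ _
      set A := ∫ ω, max (S ω - t) 0 ∂P with hAd
      set B := ∫ ω, max (t - S ω) 0 ∂P with hBd
      have key : A = 0 := by
        by_contra hne
        have hpos : 0 < A := lt_of_le_of_ne hA (Ne.symm hne)
        have hε : 0 < A / (A + B + 1) := by positivity
        have hε1 : A / (A + B + 1) < 1 := by
          rw [div_lt_one (by positivity)]; linarith
        obtain ⟨β, hβ, hβlt⟩ := exists_lt_of_csInf_lt
          (⟨1, Or.inr rfl⟩ : ({β : ℝ | β ∈ Set.Ioo (0:ℝ) 1 ∧ ex β S ≤ t} ∪ {1}).Nonempty)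
          (h0.trans_lt hε)
        rcases hβ with ⟨hβ, hle⟩ | hβ
        · have hE := hex β hβ S hSint
          unfold IsExpectile at hE
          have m1 : A ≤ ∫ ω, max (S ω - ex β S) 0 ∂P :=
            integral_mono (aux_int_pos hSint _) (aux_int_pos hSint _)
              fun ω => max_le_max (by linarith) le_rfl
          have m2 : ∫ ω, max (ex β S - S ω) 0 ∂P ≤ B :=
            integral_mono (aux_int_neg hSint _) (aux_int_neg hSint _)
              fun ω => max_le_max (by linarith) le_rfl
          have n1 := mul_le_mul_of_nonneg_left m1 (sub_nonneg.2 hβ.2.le)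
          have n2 := mul_le_mul_of_nonneg_left m2 hβ.1.le
          rw [lt_div_iff₀ (by positivity)] at hβlt
          have := hβ.1
          nlinarith
        · rw [Set.mem_singleton_iff] at hβ
          linarith
      have hz := (integral_eq_zero_iff_of_nonneg (fun ω => le_max_right _ _)
        (aux_int_pos hSint t)).1 key
      filter_upwards [hz] with ω hω
      have h2 : max (S ω - t) 0 = 0 := hω
      have := le_max_left (S ω - t) 0
      linarith
    · intro hle
      apply le_antisymm
      · apply le_of_forall_pos_lt_add
        intro ε hε
        have hm : min (ε / 2) (1 / 2) ∈
            ({β : ℝ | β ∈ Set.Ioo (0:ℝ) 1 ∧ ex β S ≤ t} ∪ {1}) := by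
          have hI : min (ε / 2) (1 / 2) ∈ Set.Ioo (0:ℝ) 1 :=
            ⟨lt_min (by linarith) (by norm_num), (min_le_right _ _).trans_lt (by norm_num)⟩
          exact Or.inl ⟨hI, aux_le_of_ae hSint hI (hex _ hI S hSint) hle⟩
        have h3 := csInf_le hbdd hm
        have h4 := min_le_left (ε / 2) (1 / 2)
        linarith
      · apply Real.sInf_nonneg
        rintro β (hβ | hβ)
        · exact hβ.1.1.le
        · rw [Set.mem_singleton_iff] at hβ
          rw [hβ]; exact zero_le_one
  refine ⟨hiff, ?_⟩
  rintro ⟨c, hc⟩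
  rw [hiff]
  have hct : c ≤ t := by
    have e1 : ∫ ω, S ω ∂P = c := by
      rw [integral_congr_ae (g := fun _ => c) hc]; simp
    have e2 : ∫ ω, S ω ∂P = ∑ i, ∫ ω, X i ω ∂P := integral_finsetSum _ fun i _ => hX i
    rw [← e1, e2]
    apply Finset.sum_le_sum
    intro i _
    exact aux_mean_le (hX i) hα
      (hex α ⟨hα.1, by have := hα.2; linarith⟩ _ (hX i))
  filter_upwards [hc] with ω hω
  exact le_of_eq_of_le hω hct
end

section
/- Let α ∈ (0,1/2), let X be an integrable non-degenerate random variable, and let λ₁,…,λₙ ≥ 0 with (λ₁,…,λₙ) ≠ (0,…,0). Then DQ^ex_α(λ₁X, λ₂X, …, λₙX) = 1. -/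
open MeasureTheory

variable {Ω : Type*} [MeasurableSpace Ω]

theorem ex_int_U (P : Measure Ω) [IsProbabilityMeasure P] {Y : Ω → ℝ} (hY : Integrable Y P) (t : ℝ) :
    Integrable (fun ω => max (Y ω - t) 0) P :=
  (hY.sub (integrable_const t)).pos_part

theorem ex_int_V (P : Measure Ω) [IsProbabilityMeasure P] {Y : Ω → ℝ} (hY : Integrable Y P) (t : ℝ) :
    Integrable (fun ω => max (t - Y ω) 0) P :=
  ((integrable_const t).sub hY).pos_part

theorem ex_diff (P : Measure Ω) [IsProbabilityMeasure P] {Y : Ω → ℝ} (hY : Integrable Y P) (t : ℝ) :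
    (∫ ω, max (Y ω - t) 0 ∂P) - ∫ ω, max (t - Y ω) 0 ∂P = (∫ ω, Y ω ∂P) - t := by
  rw [← integral_sub (ex_int_U P hY t) (ex_int_V P hY t)]
  have : ∀ ω, max (Y ω - t) 0 - max (t - Y ω) 0 = Y ω - t := by
    intro ω
    rcases le_total (Y ω) t with h | h
    · rw [max_eq_right (by linarith), max_eq_left (by linarith)]; ring
    · rw [max_eq_left (by linarith), max_eq_right (by linarith)]; ring
  simp_rw [this]
  rw [integral_sub hY (integrable_const t)]
  simp

theorem ex_U_anti (P : Measure Ω) [IsProbabilityMeasure P] {Y : Ω → ℝ} (hY : Integrable Y P) {s t : ℝ}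
    (h : s ≤ t) : ∫ ω, max (Y ω - t) 0 ∂P ≤ ∫ ω, max (Y ω - s) 0 ∂P :=
  integral_mono (ex_int_U P hY t) (ex_int_U P hY s)
    (fun ω => max_le_max (by linarith) le_rfl)

theorem ex_V_mono (P : Measure Ω) [IsProbabilityMeasure P] {Y : Ω → ℝ} (hY : Integrable Y P) {s t : ℝ}
    (h : s ≤ t) : ∫ ω, max (s - Y ω) 0 ∂P ≤ ∫ ω, max (t - Y ω) 0 ∂P :=
  integral_mono (ex_int_V P hY s) (ex_int_V P hY t)
    (fun ω => max_le_max (by linarith) le_rfl)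

theorem ex_unique_aux (P : Measure Ω) [IsProbabilityMeasure P] {Y : Ω → ℝ} (hY : Integrable Y P)
    {α s t : ℝ} (h0 : 0 < α) (h1 : α < 1) (hs : IsExpectile P α Y s) (ht : IsExpectile P α Y t) :
    t ≤ s := by
  by_contra! hlt
  unfold IsExpectile at hs ht
  have a := ex_U_anti P hY hlt.le
  have b := ex_V_mono P hY hlt.le
  have c := ex_diff P hY s
  have d := ex_diff P hY t
  have e := mul_le_mul_of_nonneg_left a (by linarith : 0 ≤ 1 - α)
  have f := mul_le_mul_of_nonneg_left b h0.le
  have g := mul_left_cancel₀ (by linarith : 1 - α ≠ 0) (le_antisymm e (by linarith))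
  have k := mul_left_cancel₀ h0.ne' (le_antisymm f (by linarith))
  linarith

theorem ex_strict (P : Measure Ω) [IsProbabilityMeasure P] {Y : Ω → ℝ} (hY : Integrable Y P)
    (hnd : ¬ ∃ c : ℝ, ∀ᵐ ω ∂P, Y ω = c)
    {α β s t : ℝ} (h0 : 0 < β) (hβ : β < α) (h1 : α < 1)
    (hs : IsExpectile P α Y s) (ht : IsExpectile P β Y t) : s < t := by
  by_contra! hle
  unfold IsExpectile at hs ht
  have a := ex_U_anti P hY hle
  have b := ex_V_mono P hY hle
  have hU : 0 ≤ ∫ ω, max (Y ω - t) 0 ∂P := integral_nonneg (fun ω => le_max_right _ _)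
  have hV : 0 ≤ ∫ ω, max (t - Y ω) 0 ∂P := integral_nonneg (fun ω => le_max_right _ _)
  have e := mul_le_mul_of_nonneg_left a (by linarith : 0 ≤ 1 - α)
  have f := mul_le_mul_of_nonneg_left b (by linarith : 0 ≤ α)
  have hU' := ex_int_U P hY t
  have hV' := ex_int_V P hY t
  have hU0 : ∫ ω, max (Y ω - t) 0 ∂P = 0 := by
    generalize (∫ ω, max (Y ω - t) 0 ∂P) = U at *
    generalize (∫ ω, max (t - Y ω) 0 ∂P) = V at *
    have g : α * V ≤ (1 - α) * U := by linarith
    have k := mul_le_mul_of_nonneg_left g h0.le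
    have k2 : β * (α * V) = α * ((1 - β) * U) := by rw [ht]; ring
    nlinarith
  have hV0 : ∫ ω, max (t - Y ω) 0 ∂P = 0 := by
    rw [hU0, mul_zero] at ht
    exact (mul_eq_zero.1 ht.symm).resolve_left h0.ne'
  have hUn : 0 ≤ fun ω => max (Y ω - t) 0 := fun ω => le_max_right _ _
  rw [integral_eq_zero_iff_of_nonneg hUn hU'] at hU0
  have hVn : 0 ≤ fun ω => max (t - Y ω) 0 := fun ω => le_max_right _ _
  rw [integral_eq_zero_iff_of_nonneg hVn hV'] at hV0
  refine hnd ⟨t, ?_⟩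
  filter_upwards [hU0, hV0] with ω p q
  simp only [Pi.zero_apply] at p q
  have := le_max_left (Y ω - t) 0
  have := le_max_left (t - Y ω) 0
  linarith

theorem ex_smul (P : Measure Ω) {Y : Ω → ℝ} {α t l : ℝ} (hl : 0 ≤ l)
    (h : IsExpectile P α Y t) : IsExpectile P α (fun ω => l * Y ω) (l * t) := by
  unfold IsExpectile at *
  have e : ∀ x : ℝ, max (l * x) 0 = l * max x 0 := fun x => by
    rw [mul_max_of_nonneg _ _ hl, mul_zero]
  simp_rw [← mul_sub, e, integral_const_mul]
  linear_combination l * h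

/-- if X is integrable and non-degenerate and λ₁,…,λₙ ≥ 0 are not all
zero, then DQ^ex_α(λ₁X,…,λₙX) = 1. -/
theorem stmt4
    (P : Measure Ω) [IsProbabilityMeasure P]
    (α : ℝ) (hα : α ∈ Set.Ioo (0:ℝ) (1/2))
    (X : Ω → ℝ) (hX : Integrable X P)
    (hXnd : ¬ ∃ c : ℝ, ∀ᵐ ω ∂P, X ω = c)
    {n : ℕ} (lam : Fin n → ℝ) (hlam : ∀ i, 0 ≤ lam i) (hlam0 : lam ≠ 0)
    (ex : ℝ → (Ω → ℝ) → ℝ)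
    (hex : ∀ β ∈ Set.Ioo (0:ℝ) 1, ∀ Y : Ω → ℝ, Integrable Y P → IsExpectile P β Y (ex β Y)) :
    DQex P ex α (fun i ω => lam i * X ω) = 1 := by
  obtain ⟨ha0, ha2⟩ := hα
  have ha1 : α < 1 := by linarith
  have hαm : α ∈ Set.Ioo (0:ℝ) 1 := ⟨ha0, ha1⟩
  have key : ∀ l : ℝ, 0 ≤ l → ex α (fun ω => l * X ω) = l * ex α X := by
    intro l hl
    have h1 := hex α hαm _ (hX.const_mul l)
    have h2 := ex_smul P hl (hex α hαm X hX)
    exact le_antisymm (ex_unique_aux P (hX.const_mul l) ha0 ha1 h2 h1)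
      (ex_unique_aux P (hX.const_mul l) ha0 ha1 h1 h2)
  have hL : 0 < ∑ i, lam i := by
    obtain ⟨i, hi⟩ := Function.ne_iff.1 hlam0
    exact Finset.sum_pos' (fun i _ => hlam i)
      ⟨i, Finset.mem_univ i, lt_of_le_of_ne (hlam i) (Ne.symm hi)⟩
  have hsum : (∑ i, ex α (fun ω => lam i * X ω)) = ex α (fun ω => (∑ i, lam i) * X ω) := by
    rw [key _ hL.le, Finset.sum_mul]
    exact Finset.sum_congr rfl (fun i _ => key _ (hlam i))
  have hnd : ¬ ∃ c : ℝ, ∀ᵐ ω ∂P, (∑ i, lam i) * X ω = c := by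
    rintro ⟨c, hc⟩
    refine hXnd ⟨c / ∑ i, lam i, ?_⟩
    filter_upwards [hc] with ω h
    rw [eq_div_iff hL.ne', ← h, mul_comm]
  have hint := hX.const_mul (∑ i, lam i)
  unfold DQex
  simp_rw [← Finset.sum_mul]
  rw [hsum]
  have hleast : IsLeast ({β : ℝ | β ∈ Set.Ioo (0:ℝ) 1 ∧
      ex β (fun ω => (∑ i, lam i) * X ω) ≤ ex α (fun ω => (∑ i, lam i) * X ω)} ∪ {1}) α := by
    refine ⟨Or.inl ⟨hαm, le_rfl⟩, ?_⟩
    rintro β (⟨hβ, hle⟩ | rfl)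
    · by_contra! hlt
      exact absurd (ex_strict P hint hnd hβ.1 hlt ha1 (hex α hαm _ hint) (hex β hβ _ hint))
        (not_lt.2 hle)
    · exact ha1.le
  rw [hleast.csInf_eq]
  exact div_self ha0.ne'
end

section
/- Let α ∈ (0,1/2) and let X₁,…,Xₙ be integrable random variables with DQ^ex_α(X₁,…,Xₙ) > 0. Then c := DQ^ex_α(X₁,…,Xₙ) lies in (0,1], satisfies ex_{cα}(X₁+⋯+Xₙ) = ex_α(X₁)+⋯+ex_α(Xₙ), and is the unique element of (0,1] with this property. -/
open MeasureTheory

variable {Ω : Type*} [MeasurableSpace Ω]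

lemma aux_int (P : Measure Ω) [IsProbabilityMeasure P] (Y : Ω → ℝ) (hY : Integrable Y P) (t : ℝ) :
    Integrable (fun ω => max (Y ω - t) 0) P ∧ Integrable (fun ω => max (t - Y ω) 0) P :=
  ⟨(hY.sub (integrable_const t)).pos_part, ((integrable_const t).sub hY).pos_part⟩

lemma aux_sub (P : Measure Ω) [IsProbabilityMeasure P] (Y : Ω → ℝ) (hY : Integrable Y P) (t : ℝ) :
    (∫ ω, max (Y ω - t) 0 ∂P) - ∫ ω, max (t - Y ω) 0 ∂P = (∫ ω, Y ω ∂P) - t := by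
  obtain ⟨h1, h2⟩ := aux_int P Y hY t
  rw [← integral_sub h1 h2]
  have : ∀ ω, max (Y ω - t) 0 - max (t - Y ω) 0 = Y ω - t := by
    intro ω
    rcases le_total (Y ω) t with h | h
    · rw [max_eq_right (by linarith), max_eq_left (by linarith)]; ring
    · rw [max_eq_left (by linarith), max_eq_right (by linarith)]; ring
  simp_rw [this]
  rw [integral_sub hY (integrable_const t)]
  simp

lemma aux_mono (P : Measure Ω) [IsProbabilityMeasure P] (Y : Ω → ℝ) (hY : Integrable Y P)
    (β : ℝ) (hβ : β ∈ Set.Ioo (0:ℝ) 1) (s t : ℝ) (hst : s < t) :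
    (1 - β) * (∫ ω, max (Y ω - t) 0 ∂P) - β * ∫ ω, max (t - Y ω) 0 ∂P <
    (1 - β) * (∫ ω, max (Y ω - s) 0 ∂P) - β * ∫ ω, max (s - Y ω) 0 ∂P := by
  obtain ⟨hs1, hs2⟩ := aux_int P Y hY s
  obtain ⟨ht1, ht2⟩ := aux_int P Y hY t
  have es := aux_sub P Y hY s
  have et := aux_sub P Y hY t
  have h1 := integral_mono ht1 hs1 (fun ω => max_le_max_right 0 (by linarith))
  have h2 := integral_mono hs2 ht2 (fun ω => max_le_max_right 0 (by linarith))
  obtain ⟨hb0, hb1⟩ := hβ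
  generalize (∫ ω, max (Y ω - s) 0 ∂P) = a at *
  generalize (∫ ω, max (Y ω - t) 0 ∂P) = b at *
  generalize (∫ ω, max (s - Y ω) 0 ∂P) = c at *
  generalize (∫ ω, max (t - Y ω) 0 ∂P) = d at *
  rcases le_or_gt d c with h | h
  · nlinarith [mul_pos (sub_pos.2 hb1) (show 0 < a - b by linarith), mul_nonneg hb0.le (sub_nonneg.2 h2)]
  · nlinarith [mul_nonneg (sub_pos.2 hb1).le (show 0 ≤ a - b by linarith), mul_pos hb0 (sub_pos.2 h)]

lemma aux_le_iff (P : Measure Ω) [IsProbabilityMeasure P] (Y : Ω → ℝ) (hY : Integrable Y P)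
    (β : ℝ) (hβ : β ∈ Set.Ioo (0:ℝ) 1) (e t : ℝ) (he : IsExpectile P β Y e) :
    e ≤ t ↔ (1 - β) * (∫ ω, max (Y ω - t) 0 ∂P) - β * (∫ ω, max (t - Y ω) 0 ∂P) ≤ 0 := by
  unfold IsExpectile at he
  constructor
  · intro h
    rcases h.eq_or_lt with rfl | h
    · linarith
    · have := aux_mono P Y hY β hβ _ _ h
      linarith
  · intro h
    by_contra hc
    have := aux_mono P Y hY β hβ _ _ (not_le.1 hc)
    linarith

lemma aux_eq_iff (P : Measure Ω) [IsProbabilityMeasure P] (Y : Ω → ℝ) (hY : Integrable Y P)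
    (β : ℝ) (hβ : β ∈ Set.Ioo (0:ℝ) 1) (e t : ℝ) (he : IsExpectile P β Y e) :
    e = t ↔ (1 - β) * (∫ ω, max (Y ω - t) 0 ∂P) - β * (∫ ω, max (t - Y ω) 0 ∂P) = 0 := by
  constructor
  · rintro rfl
    unfold IsExpectile at he
    linarith
  · intro h
    refine le_antisymm ((aux_le_iff P Y hY β hβ e t he).2 h.le) ?_
    by_contra hc
    have := aux_mono P Y hY β hβ _ _ (not_le.1 hc)
    unfold IsExpectile at he
    linarith

lemma aux_subadd (P : Measure Ω) [IsProbabilityMeasure P]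
    (α : ℝ) (hα : α ∈ Set.Ioo (0:ℝ) (1/2))
    {n : ℕ} (X : Fin n → Ω → ℝ) (hX : ∀ i, Integrable (X i) P) (t : Fin n → ℝ)
    (ht : ∀ i, IsExpectile P α (X i) (t i)) :
    (1 - α) * (∫ ω, max ((∑ i, X i ω) - ∑ i, t i) 0 ∂P)
      - α * (∫ ω, max ((∑ i, t i) - ∑ i, X i ω) 0 ∂P) ≤ 0 := by
  have hS : Integrable (fun ω => ∑ i, X i ω) P := integrable_finsetSum _ (fun i _ => hX i)
  have e := aux_sub P _ hS (∑ i, t i)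
  have hm : (∫ ω, ∑ i, X i ω ∂P) = ∑ i, ∫ ω, X i ω ∂P := integral_finsetSum _ (fun i _ => hX i)
  have hle : (∫ ω, max ((∑ i, X i ω) - ∑ i, t i) 0 ∂P) ≤ ∑ i, ∫ ω, max (X i ω - t i) 0 ∂P := by
    rw [← integral_finsetSum _ (fun i _ => (aux_int P _ (hX i) (t i)).1)]
    refine integral_mono (aux_int P _ hS _).1
      (integrable_finsetSum _ (fun i _ => (aux_int P _ (hX i) (t i)).1)) (fun ω => ?_)
    refine max_le ?_ (Finset.sum_nonneg fun i _ => le_max_right _ _)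
    rw [← Finset.sum_sub_distrib]
    exact Finset.sum_le_sum fun i _ => le_max_left _ _
  have hz : α * ((∑ i, ∫ ω, X i ω ∂P) - ∑ i, t i)
      + (1 - 2 * α) * ∑ i, ∫ ω, max (X i ω - t i) 0 ∂P = 0 := by
    rw [← Finset.sum_sub_distrib, Finset.mul_sum, Finset.mul_sum, ← Finset.sum_add_distrib]
    refine Finset.sum_eq_zero fun i _ => ?_
    have h1 := aux_sub P _ (hX i) (t i)
    have h2 := ht i
    unfold IsExpectile at h2
    rw [← h1]
    linarith
  obtain ⟨ha0, ha1⟩ := hα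
  rw [hm] at e
  rw [← e] at hz
  nlinarith [mul_le_mul_of_nonneg_left hle (show 0 ≤ 1 - 2 * α by linarith)]

/-- if DQ^ex_α(X) > 0, then c := DQ^ex_α(X) lies in (0,1], satisfies
ex_{cα}(∑ᵢ Xᵢ) = ∑ᵢ ex_α(Xᵢ), and is the unique element of (0,1] with this property. -/
theorem stmt5
    (P : Measure Ω) [IsProbabilityMeasure P]
    (α : ℝ) (hα : α ∈ Set.Ioo (0:ℝ) (1/2))
    {n : ℕ} (X : Fin n → Ω → ℝ) (hX : ∀ i, Integrable (X i) P)
    (ex : ℝ → (Ω → ℝ) → ℝ)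
    (hex : ∀ β ∈ Set.Ioo (0:ℝ) 1, ∀ Y : Ω → ℝ, Integrable Y P → IsExpectile P β Y (ex β Y))
    (hpos : 0 < DQex P ex α X) :
    DQex P ex α X ∈ Set.Ioc (0:ℝ) 1 ∧
    ex (DQex P ex α X * α) (fun ω => ∑ i, X i ω) = ∑ i, ex α (X i) ∧
    (∀ c ∈ Set.Ioc (0:ℝ) 1,
      ex (c * α) (fun ω => ∑ i, X i ω) = ∑ i, ex α (X i) → c = DQex P ex α X) := by
  have hα1 : α ∈ Set.Ioo (0:ℝ) 1 := ⟨hα.1, by linarith [hα.2]⟩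
  have hα0 : 0 < α := hα.1
  have hS : Integrable (fun ω => ∑ i, X i ω) P := integrable_finsetSum _ (fun i _ => hX i)
  have hsub := aux_subadd P α hα X hX (fun i => ex α (X i)) (fun i => hex α hα1 _ (hX i))
  have hle := fun β (hβ : β ∈ Set.Ioo (0:ℝ) 1) =>
    aux_le_iff P _ hS β hβ _ (∑ i, ex α (X i)) (hex β hβ _ hS)
  have heq := fun β (hβ : β ∈ Set.Ioo (0:ℝ) 1) =>
    aux_eq_iff P _ hS β hβ _ (∑ i, ex α (X i)) (hex β hβ _ hS)
  have hA : 0 ≤ ∫ ω, max ((∑ i, X i ω) - ∑ i, ex α (X i)) 0 ∂P :=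
    integral_nonneg fun ω => le_max_right _ _
  have hB : 0 ≤ ∫ ω, max ((∑ i, ex α (X i)) - ∑ i, X i ω) 0 ∂P :=
    integral_nonneg fun ω => le_max_right _ _
  generalize (∫ ω, max ((∑ i, X i ω) - ∑ i, ex α (X i)) 0 ∂P) = A at *
  generalize (∫ ω, max ((∑ i, ex α (X i)) - ∑ i, X i ω) 0 ∂P) = B at *
  obtain ⟨q, hq⟩ : ∃ q, q = DQex P ex α X * α := ⟨_, rfl⟩
  have hq' : q = sInf ({β : ℝ | β ∈ Set.Ioo (0:ℝ) 1 ∧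
      ex β (fun ω => ∑ i, X i ω) ≤ ∑ i, ex α (X i)} ∪ {1}) := by
    rw [hq, DQex, div_mul_cancel₀ _ hα0.ne']
  have hq0 : 0 < q := by rw [hq]; positivity
  have hbdd : BddBelow ({β : ℝ | β ∈ Set.Ioo (0:ℝ) 1 ∧
      ex β (fun ω => ∑ i, X i ω) ≤ ∑ i, ex α (X i)} ∪ {1}) := by
    refine ⟨0, ?_⟩
    rintro x (hx | hx)
    · exact hx.1.1.le
    · rw [hx]; exact zero_le_one
  have hqle : ∀ β ∈ Set.Ioo (0:ℝ) 1, (1 - β) * A - β * B ≤ 0 → q ≤ β := by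
    intro β hβ h
    rw [hq']
    exact csInf_le hbdd (Or.inl ⟨hβ, (hle β hβ).2 h⟩)
  have hqα : q ≤ α := hqle α hα1 hsub
  have hq1 : q < 1 := by linarith [hα.2]
  have hApos : 0 < A := by
    by_contra hc
    have hA0 : A = 0 := le_antisymm (not_lt.1 hc) hA
    have := hqle (q / 2) ⟨by linarith, by linarith⟩ (by rw [hA0]; nlinarith)
    linarith
  have hAB : 0 < A + B := by linarith
  have hr0 : 0 < A / (A + B) := div_pos hApos hAB
  have hr : A / (A + B) * (A + B) = A := div_mul_cancel₀ _ hAB.ne'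
  have hrα : A / (A + B) ≤ α := by
    rw [div_le_iff₀ hAB]; linarith
  have hqr : q = A / (A + B) := by
    apply le_antisymm
    · exact hqle _ ⟨hr0, by linarith [hα.2]⟩ (by linarith)
    · rw [hq']
      refine le_csInf ⟨1, Or.inr rfl⟩ ?_
      rintro x (hx | hx)
      · have := (hle x hx.1).1 hx.2
        rw [div_le_iff₀ hAB]; linarith
      · rw [hx]; linarith [hα.2]
  refine ⟨⟨hpos, ?_⟩, ?_, ?_⟩
  · by_contra hc
    have := mul_lt_mul_of_pos_right (not_le.1 hc) hα0
    linarith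
  · rw [← hq]
    refine (heq q ⟨hq0, hq1⟩).2 ?_
    rw [hqr]; linarith
  · intro c hc h
    have hcα : c * α ≤ 1 * α := mul_le_mul_of_nonneg_right hc.2 hα0.le
    have h1 := (heq (c * α) ⟨mul_pos hc.1 hα0, by linarith [hα.2]⟩).1 h
    have h2 : c * α = q := by
      rw [hqr, eq_div_iff hAB.ne']; linarith
    rw [hq] at h2
    exact mul_right_cancel₀ hα0.ne' h2
end

section
/- Let α ∈ (0,1/2) and let X₁,…,Xₙ be integrable random variables. Define g : [0,∞)ⁿ → ℝ by g(w) = DQ^ex_α(w₁X₁,…,wₙXₙ). Then g is quasi-convex on [0,∞)ⁿ: for all w, v ∈ [0,∞)ⁿ and all λ ∈ [0,1], g(λw + (1−λ)v) ≤ max{g(w), g(v)}. -/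
open MeasureTheory

variable {Ω : Type*} [MeasurableSpace Ω]

/-- The expectile score function. -/
noncomputable def phi (β x : ℝ) : ℝ := (1 - β) * max x 0 - β * max (-x) 0

lemma phi_mul (β w x : ℝ) (hw : 0 ≤ w) : phi β (w * x) = w * phi β x := by
  unfold phi
  have h1 : max (w * x) 0 = w * max x 0 := by
    rw [mul_max_of_nonneg _ _ hw, mul_zero]
  have h2 : max (-(w * x)) 0 = w * max (-x) 0 := by
    rw [mul_max_of_nonneg _ _ hw, mul_zero, mul_neg]
  rw [h1, h2]; ring

lemma phi_pos (β x : ℝ) (hx : 0 ≤ x) : phi β x = (1 - β) * x := by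
  unfold phi
  rw [max_eq_left hx, max_eq_right (by linarith)]; ring

lemma phi_neg (β x : ℝ) (hx : x ≤ 0) : phi β x = β * x := by
  unfold phi
  rw [max_eq_right hx, max_eq_left (by linarith)]; ring

lemma phi_add (β x y : ℝ) (hb : β ≤ 1 / 2) : phi β (x + y) ≤ phi β x + phi β y := by
  rcases le_total 0 x with hx | hx <;> rcases le_total 0 y with hy | hy <;>
    rcases le_total 0 (x + y) with h | h <;>
    simp only [phi_pos, phi_neg, hx, hy, h] <;> nlinarith

lemma phi_anti (β γ x : ℝ) (h : β ≤ γ) : phi γ x ≤ phi β x := by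
  rcases le_total 0 x with hx | hx <;> simp only [phi_pos, phi_neg, hx] <;> nlinarith

lemma phi_mono (β x y : ℝ) (h0 : 0 < β) (h1 : β < 1) (h : x ≤ y) :
    phi β x + min β (1 - β) * (y - x) ≤ phi β y := by
  have a := min_le_left β (1 - β)
  have b := min_le_right β (1 - β)
  rcases le_total 0 x with hx | hx <;> rcases le_total 0 y with hy | hy <;>
    simp only [phi_pos, phi_neg, hx, hy] <;> nlinarith

lemma phi_sum {n : ℕ} (β : ℝ) (hb : β ≤ 1 / 2) (f : Fin n → ℝ) (s : Finset (Fin n)) :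
    phi β (∑ i ∈ s, f i) ≤ ∑ i ∈ s, phi β (f i) := by
  classical
  induction s using Finset.induction_on with
  | empty => simp [phi]
  | insert a s ha ih =>
    rw [Finset.sum_insert ha, Finset.sum_insert ha]
    have := phi_add β (f a) (∑ i ∈ s, f i) hb
    linarith

lemma phi_int (P : Measure Ω) (β : ℝ) (Y : Ω → ℝ) (hY : Integrable Y P) :
    Integrable (fun ω => phi β (Y ω)) P := by
  unfold phi
  exact (hY.pos_part.const_mul _).sub (hY.neg_part.const_mul _)

lemma isExp_iff (P : Measure Ω) [IsProbabilityMeasure P] (β : ℝ) (Y : Ω → ℝ)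
    (hY : Integrable Y P) (t : ℝ) :
    IsExpectile P β Y t ↔ ∫ ω, phi β (Y ω - t) ∂P = 0 := by
  have hYt : Integrable (fun ω => Y ω - t) P := hY.sub (integrable_const t)
  unfold IsExpectile phi
  rw [integral_sub (hYt.pos_part.const_mul _) (hYt.neg_part.const_mul _),
    integral_const_mul, integral_const_mul, sub_eq_zero]
  simp only [neg_sub]

lemma exp_le_iff (P : Measure Ω) [IsProbabilityMeasure P] (β : ℝ) (h0 : 0 < β) (h1 : β < 1)
    (Y : Ω → ℝ) (hY : Integrable Y P) (t s : ℝ) (ht : IsExpectile P β Y t) :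
    t ≤ s ↔ ∫ ω, phi β (Y ω - s) ∂P ≤ 0 := by
  rw [isExp_iff P β Y hY] at ht
  have hI : ∀ r : ℝ, Integrable (fun ω => phi β (Y ω - r)) P := fun r =>
    phi_int P β _ (hY.sub (integrable_const r))
  have hc : 0 < min β (1 - β) := lt_min h0 (by linarith)
  constructor
  · intro h
    rw [← ht]
    refine integral_mono (hI s) (hI t) fun ω => ?_
    have := phi_mono β (Y ω - s) (Y ω - t) h0 h1 (by linarith)
    have h2 : 0 ≤ min β (1 - β) * (Y ω - t - (Y ω - s)) :=
      mul_nonneg hc.le (by linarith)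
    show phi β (Y ω - s) ≤ phi β (Y ω - t)
    linarith
  · intro h
    by_contra hlt
    push Not at hlt
    have key : ∫ ω, (phi β (Y ω - t) + min β (1 - β) * (t - s)) ∂P
        ≤ ∫ ω, phi β (Y ω - s) ∂P := by
      refine integral_mono ((hI t).add (integrable_const _)) (hI s) fun ω => ?_
      have := phi_mono β (Y ω - t) (Y ω - s) h0 h1 (by linarith)
      have e : Y ω - s - (Y ω - t) = t - s := by ring
      rw [e] at this
      exact this
    rw [integral_add (hI t) (integrable_const _), ht] at key
    simp only [integral_const, probReal_univ, one_smul, zero_add] at key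
    have : 0 < min β (1 - β) * (t - s) := mul_pos hc (by linarith)
    linarith

/-- quasi-convexity of w ↦ DQ^ex_α(w ⊙ X) on [0,∞)ⁿ. -/
theorem stmt8
    (P : Measure Ω) [IsProbabilityMeasure P]
    (α : ℝ) (hα : α ∈ Set.Ioo (0:ℝ) (1/2))
    {n : ℕ} (X : Fin n → Ω → ℝ) (hX : ∀ i, Integrable (X i) P)
    (ex : ℝ → (Ω → ℝ) → ℝ)
    (hex : ∀ β ∈ Set.Ioo (0:ℝ) 1, ∀ Y : Ω → ℝ, Integrable Y P → IsExpectile P β Y (ex β Y))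
    (g : (Fin n → ℝ) → ℝ)
    (hg : ∀ w, g w = DQex P ex α (fun i ω => w i * X i ω)) :
    ∀ w v : Fin n → ℝ, (∀ i, 0 ≤ w i) → (∀ i, 0 ≤ v i) →
      ∀ l ∈ Set.Icc (0:ℝ) 1,
        g (fun i => l * w i + (1 - l) * v i) ≤ max (g w) (g v) := by
  intro w v hw hv l hl
  obtain ⟨ha0, ha1⟩ := hα
  have hα1 : α < 1 := by linarith
  set c : Fin n → ℝ := fun i => ex α (X i) with hc
  set S : (Fin n → ℝ) → Ω → ℝ := fun u ω => ∑ i, u i * (X i ω - c i) with hS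
  have hSint : ∀ u, Integrable (S u) P := fun u =>
    integrable_finsetSum _ fun i _ => ((hX i).sub (integrable_const (c i))).const_mul (u i)
  have hci : ∀ i, ∫ ω, phi α (X i ω - c i) ∂P = 0 := fun i =>
    (isExp_iff P α (X i) (hX i) (c i)).1 (hex α ⟨ha0, hα1⟩ _ (hX i))
  have hhom : ∀ u : Fin n → ℝ, (∀ i, 0 ≤ u i) → ∀ i,
      ex α (fun ω => u i * X i ω) = u i * c i := by
    intro u hu i
    have hY : Integrable (fun ω => u i * X i ω) P := (hX i).const_mul _
    have e1 := hex α ⟨ha0, hα1⟩ _ hY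
    have e2 : IsExpectile P α (fun ω => u i * X i ω) (u i * c i) := by
      rw [isExp_iff P α _ hY]
      have : ∀ ω, phi α (u i * X i ω - u i * c i) = u i * phi α (X i ω - c i) := by
        intro ω
        rw [← mul_sub, phi_mul _ _ _ (hu i)]
      simp only [this]
      rw [integral_const_mul, hci, mul_zero]
    apply le_antisymm
    · exact (exp_le_iff P α ha0 hα1 _ hY _ _ e1).2 ((isExp_iff P α _ hY _).1 e2).le
    · exact (exp_le_iff P α ha0 hα1 _ hY _ _ e2).2 ((isExp_iff P α _ hY _).1 e1).le
  let A : (Fin n → ℝ) → Set ℝ := fun u =>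
    {β : ℝ | β ∈ Set.Ioo (0:ℝ) 1 ∧ ∫ ω, phi β (S u ω) ∂P ≤ 0} ∪ {1}
  have hgA : ∀ u : Fin n → ℝ, (∀ i, 0 ≤ u i) → g u = sInf (A u) / α := by
    intro u hu
    rw [hg, DQex]
    congr 2
    simp only [A]
    congr 1
    ext β
    simp only [Set.mem_ofPred_eq]
    refine and_congr_right fun hβ => ?_
    have hY : Integrable (fun ω => ∑ i, u i * X i ω) P :=
      integrable_finsetSum _ fun i _ => (hX i).const_mul (u i)
    rw [exp_le_iff P β hβ.1 hβ.2 _ hY _ _ (hex β hβ _ hY)]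
    have : ∀ ω, ∑ i, u i * X i ω - ∑ i, ex α (fun ω => u i * X i ω) = S u ω := by
      intro ω
      simp only [hS, hhom u hu, mul_sub, Finset.sum_sub_distrib]
    simp only [this]
  have hbdd : ∀ u, BddBelow (A u) := by
    intro u
    refine ⟨0, ?_⟩
    rintro β (h | h)
    · exact h.1.1.le
    · rw [Set.mem_singleton_iff.1 h]; norm_num
  have hne : ∀ u, (A u).Nonempty := fun u => ⟨1, Or.inr rfl⟩
  have hαA : ∀ u : Fin n → ℝ, (∀ i, 0 ≤ u i) → α ∈ A u := by
    intro u hu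
    refine Or.inl ⟨⟨ha0, hα1⟩, ?_⟩
    have hI : ∀ i, Integrable (fun ω => u i * phi α (X i ω - c i)) P := fun i =>
      (phi_int P α _ ((hX i).sub (integrable_const (c i)))).const_mul _
    calc ∫ ω, phi α (S u ω) ∂P ≤ ∫ ω, ∑ i, u i * phi α (X i ω - c i) ∂P := by
          refine integral_mono (phi_int P α _ (hSint u))
            (integrable_finsetSum _ fun i _ => hI i) fun ω => ?_
          have := phi_sum α ha1.le (fun i => u i * (X i ω - c i)) Finset.univ
          simp only [phi_mul _ _ _ (hu _)] at this
          exact this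
      _ = 0 := by
          rw [integral_finsetSum _ fun i _ => hI i]
          simp only [integral_const_mul, hci, mul_zero, Finset.sum_const_zero]
  have hup : ∀ u β, β < 1 → sInf (A u) < β → 0 < β ∧ ∫ ω, phi β (S u ω) ∂P ≤ 0 := by
    intro u β hβ h
    obtain ⟨γ, hγ, hγβ⟩ := (csInf_lt_iff (hbdd u) (hne u)).1 h
    rcases hγ with hγ | hγ
    · refine ⟨hγ.1.1.trans hγβ, le_trans ?_ hγ.2⟩
      exact integral_mono (phi_int P _ _ (hSint u)) (phi_int P _ _ (hSint u))
        fun ω => phi_anti γ β _ hγβ.le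
    · rw [Set.mem_singleton_iff.1 hγ] at hγβ
      linarith
  have hl1 : 0 ≤ 1 - l := by linarith [hl.2]
  have hu : ∀ i, 0 ≤ l * w i + (1 - l) * v i := fun i =>
    add_nonneg (mul_nonneg hl.1 (hw i)) (mul_nonneg hl1 (hv i))
  rw [hgA _ hu, hgA w hw, hgA v hv, max_div_div_right ha0.le]
  refine div_le_div_of_nonneg_right ?_ ha0.le
  refine le_of_forall_gt_imp_ge_of_dense fun β hβ => ?_
  rcases le_or_gt α β with h | h
  · exact (csInf_le (hbdd _) (hαA _ hu)).trans h
  · have hβ1 : β < 1 := by linarith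
    obtain ⟨hb0, hbw⟩ := hup w β hβ1 ((le_max_left _ _).trans_lt hβ)
    obtain ⟨-, hbv⟩ := hup v β hβ1 ((le_max_right _ _).trans_lt hβ)
    refine csInf_le (hbdd _) (Or.inl ⟨⟨hb0, hβ1⟩, ?_⟩)
    have hIw := (phi_int P β _ (hSint w)).const_mul l
    have hIv := (phi_int P β _ (hSint v)).const_mul (1 - l)
    calc ∫ ω, phi β (S (fun i => l * w i + (1 - l) * v i) ω) ∂P
        ≤ ∫ ω, (l * phi β (S w ω) + (1 - l) * phi β (S v ω)) ∂P := by
          refine integral_mono (phi_int P β _ (hSint _)) (hIw.add hIv) fun ω => ?_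
          have e : S (fun i => l * w i + (1 - l) * v i) ω = l * S w ω + (1 - l) * S v ω := by
            simp only [hS, Finset.mul_sum, ← Finset.sum_add_distrib]
            refine Finset.sum_congr rfl fun i _ => ?_
            ring
          have := phi_add β (l * S w ω) ((1 - l) * S v ω) (by linarith)
          rw [phi_mul _ _ _ hl.1, phi_mul _ _ _ hl1, ← e] at this
          exact this
      _ = l * ∫ ω, phi β (S w ω) ∂P + (1 - l) * ∫ ω, phi β (S v ω) ∂P := by
          rw [integral_add hIw hIv, integral_const_mul, integral_const_mul]
      _ ≤ 0 := by nlinarith [hl.1]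
end

section
/- Let α ∈ (0,1/2) and let Y be an integrable non-degenerate random variable with E[Y] = 0. Set e = ex_α(Y); then e > 0. Define h(k) = E[(Y − k·e)₊] / (α·E[|Y − k·e|]) for k ≥ 1. Then h(1) = 1 and h is decreasing on [1,∞): for all 1 ≤ k₁ ≤ k₂, h(k₂) ≤ h(k₁). -/
open MeasureTheory

variable {Ω : Type*} [MeasurableSpace Ω]

/-- for integrable non-degenerate Y with E[Y] = 0 and e = ex_α(Y), one
has e > 0, h(1) = 1 and h is decreasing on [1,∞), where
h(k) = E[(Y − k·e)₊]/(α·E[|Y − k·e|]). -/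
theorem stmt12
    (P : Measure Ω) [IsProbabilityMeasure P]
    (α : ℝ) (hα : α ∈ Set.Ioo (0:ℝ) (1/2))
    (Y : Ω → ℝ) (hY : Integrable Y P)
    (hYnd : ¬ ∃ c : ℝ, ∀ᵐ ω ∂P, Y ω = c)
    (hEY : ∫ ω, Y ω ∂P = 0)
    (e : ℝ) (he : IsExpectile P α Y e)
    (h : ℝ → ℝ)
    (hh : ∀ k, h k = (∫ ω, max (Y ω - k * e) 0 ∂P) /
        (α * ∫ ω, |Y ω - k * e| ∂P)) :
    0 < e ∧ h 1 = 1 ∧ (∀ k₁ k₂ : ℝ, 1 ≤ k₁ → k₁ ≤ k₂ → h k₂ ≤ h k₁) := by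
  obtain ⟨hα0, hα1⟩ := hα
  have hiA : ∀ t : ℝ, Integrable (fun ω => max (Y ω - t) 0) P := fun t =>
    (hY.sub (integrable_const t)).pos_part
  have hiB : ∀ t : ℝ, Integrable (fun ω => max (t - Y ω) 0) P := fun t =>
    ((integrable_const t).sub hY).pos_part
  have hA0 : ∀ t : ℝ, 0 ≤ ∫ ω, max (Y ω - t) 0 ∂P := fun t =>
    integral_nonneg fun ω => le_max_right _ _
  have hAB : ∀ t : ℝ, (∫ ω, max (t - Y ω) 0 ∂P) = (∫ ω, max (Y ω - t) 0 ∂P) + t := by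
    intro t
    have h1 : (∫ ω, (max (t - Y ω) 0 - max (Y ω - t) 0) ∂P) = ∫ ω, (t - Y ω) ∂P := by
      congr 1
      funext ω
      rcases le_total (Y ω) t with hc | hc
      · rw [max_eq_left (by linarith), max_eq_right (by linarith)]; ring
      · rw [max_eq_right (by linarith), max_eq_left (by linarith)]; ring
    rw [integral_sub (hiB t) (hiA t), integral_sub (integrable_const t) hY, hEY] at h1
    simp at h1
    linarith
  have habs : ∀ t : ℝ, (∫ ω, |Y ω - t| ∂P) = 2 * (∫ ω, max (Y ω - t) 0 ∂P) + t := by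
    intro t
    have h1 : (∫ ω, |Y ω - t| ∂P) = ∫ ω, (max (t - Y ω) 0 + max (Y ω - t) 0) ∂P := by
      congr 1
      funext ω
      rcases le_total (Y ω) t with hc | hc
      · rw [max_eq_left (by linarith), max_eq_right (by linarith),
          abs_of_nonpos (by linarith)]; ring
      · rw [max_eq_right (by linarith), max_eq_left (by linarith),
          abs_of_nonneg (by linarith)]; ring
    rw [h1, integral_add (hiB t) (hiA t), hAB t]
    ring
  unfold IsExpectile at he
  rw [hAB e] at he
  have hkey : (1 - 2 * α) * (∫ ω, max (Y ω - e) 0 ∂P) = α * e := by linarith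
  have he0 : 0 ≤ e := by
    have : 0 ≤ α * e := by
      rw [← hkey]; exact mul_nonneg (by linarith) (hA0 e)
    exact nonneg_of_mul_nonneg_right this hα0
  have hepos : 0 < e := by
    refine lt_of_le_of_ne he0 fun h0 => hYnd ⟨0, ?_⟩
    subst h0
    have hAz : (∫ ω, max (Y ω - 0) 0 ∂P) = 0 := by
      rw [mul_zero] at hkey
      rcases mul_eq_zero.1 hkey with h1 | h1
      · linarith
      · exact h1
    have h2 := habs 0
    rw [hAz] at h2
    have h3 : (∫ ω, |Y ω - 0| ∂P) = 0 := by linarith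
    have hi : Integrable (fun ω => |Y ω - 0|) P := (hY.sub (integrable_const 0)).abs
    rw [integral_eq_zero_iff_of_nonneg (fun ω => abs_nonneg _) hi] at h3
    filter_upwards [h3] with ω hω
    simpa using hω
  have hApos : 0 < ∫ ω, max (Y ω - e) 0 ∂P := by
    have h1 : 0 < α * e := mul_pos hα0 hepos
    rw [← hkey] at h1
    exact pos_of_mul_pos_right h1 (by linarith)
  refine ⟨hepos, ?_, ?_⟩
  · rw [hh 1, one_mul, habs e]
    have h1 : α * (2 * (∫ ω, max (Y ω - e) 0 ∂P) + e) = ∫ ω, max (Y ω - e) 0 ∂P := by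
      linarith
    rw [h1]
    exact div_self hApos.ne'
  · intro k₁ k₂ h1 h12
    have ht1 : 0 < k₁ * e := mul_pos (by linarith) hepos
    have ht12 : k₁ * e ≤ k₂ * e := mul_le_mul_of_nonneg_right h12 he0
    have hmono : (∫ ω, max (Y ω - k₂ * e) 0 ∂P) ≤ ∫ ω, max (Y ω - k₁ * e) 0 ∂P :=
      integral_mono (hiA _) (hiA _) fun ω => max_le_max (by linarith) le_rfl
    have a1 := hA0 (k₁ * e)
    have a2 := hA0 (k₂ * e)
    rw [hh k₁, hh k₂, habs, habs]
    generalize (∫ ω, max (Y ω - k₁ * e) 0 ∂P) = A1 at *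
    generalize (∫ ω, max (Y ω - k₂ * e) 0 ∂P) = A2 at *
    rw [div_le_div_iff₀ (mul_pos hα0 (by linarith)) (mul_pos hα0 (by linarith))]
    have h5 : A2 * (k₁ * e) ≤ A1 * (k₂ * e) := mul_le_mul hmono ht12 ht1.le a1
    have h6 := mul_le_mul_of_nonneg_left h5 hα0.le
    linarith
end

section
/- Let α ∈ (0,1/2), n ≥ 1, and let Σ be an n×n real positive semidefinite matrix with wᵀΣw > 0 for every w in the simplex Δₙ = {w ∈ [0,1]ⁿ : w₁+⋯+wₙ = 1}. Let σᵢ = √(Σᵢᵢ) and σ = (σ₁,…,σₙ). Let Y be an integrable non-degenerate random variable with E[Y] = 0, let μ ∈ ℝⁿ, and let X₁,…,Xₙ be integrable random variables such that Xᵢ has the same distribution as μᵢ + σᵢ·Y for each i, and, for every w ∈ Δₙ, Σᵢ wᵢXᵢ has the same distribution as wᵀμ + √(wᵀΣw)·Y. Then: (a) for every w ∈ Δₙ, DQ^ex_α(w₁X₁,…,wₙXₙ) = E[(Y − k(w)·ex_α(Y))₊] / (α·E[|Y − k(w)·ex_α(Y)|]), where k(w) = (wᵀσ)/√(wᵀΣw);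 and (b) every w* ∈ Δₙ that maximizes k(w) over Δₙ minimizes DQ^ex_α(w₁X₁,…,wₙXₙ) over Δₙ. -/
open MeasureTheory

variable {Ω : Type*} [MeasurableSpace Ω]

/-- The defect function whose zero is the expectile. -/
noncomputable def gE {Ω : Type*} [MeasurableSpace Ω] (P : Measure Ω) (β : ℝ) (Z : Ω → ℝ) (t : ℝ) : ℝ :=
  (1 - β) * ∫ ω, max (Z ω - t) 0 ∂P - β * ∫ ω, max (t - Z ω) 0 ∂P

lemma isExp_iff_s13 (P : Measure Ω) (β : ℝ) (Z : Ω → ℝ) (t : ℝ) :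
    IsExpectile P β Z t ↔ gE P β Z t = 0 := by
  unfold IsExpectile gE
  exact sub_eq_zero.symm

lemma int_up (P : Measure Ω) [IsProbabilityMeasure P] {Z : Ω → ℝ} (hZ : Integrable Z P) (t : ℝ) :
    Integrable (fun ω => max (Z ω - t) 0) P :=
  (hZ.sub (integrable_const t)).pos_part

lemma int_dn (P : Measure Ω) [IsProbabilityMeasure P] {Z : Ω → ℝ} (hZ : Integrable Z P) (t : ℝ) :
    Integrable (fun ω => max (t - Z ω) 0) P :=
  ((integrable_const t).sub hZ).pos_part

lemma gE_strictAnti (P : Measure Ω) [IsProbabilityMeasure P] {β : ℝ} (hβ : β ∈ Set.Ioo (0:ℝ) 1)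
    {Z : Ω → ℝ} (hZ : Integrable Z P) : StrictAnti (gE P β Z) := by
  obtain ⟨h0, h1⟩ := hβ
  intro s t hst
  have e : ∀ t, gE P β Z t = ∫ ω, ((1 - β) * max (Z ω - t) 0 - β * max (t - Z ω) 0) ∂P := by
    intro t
    rw [integral_sub ((int_up P hZ t).const_mul _) ((int_dn P hZ t).const_mul _),
      integral_const_mul, integral_const_mul]
    rfl
  have hi : ∀ t, Integrable (fun ω => (1 - β) * max (Z ω - t) 0 - β * max (t - Z ω) 0) P :=
    fun t => ((int_up P hZ t).const_mul _).sub ((int_dn P hZ t).const_mul _)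
  have key : ∫ ω, (((1 - β) * max (Z ω - t) 0 - β * max (t - Z ω) 0) + min β (1-β) * (t - s)) ∂P
      ≤ ∫ ω, ((1 - β) * max (Z ω - s) 0 - β * max (s - Z ω) 0) ∂P := by
    refine integral_mono ((hi t).add (integrable_const _)) (hi s) ?_
    intro ω
    dsimp only
    have m1 := min_le_left β (1-β)
    have m2 := min_le_right β (1-β)
    generalize min β (1-β) = m at *
    rcases le_total (Z ω) s with h | h
    · rw [max_eq_right (by linarith), max_eq_left (by linarith), max_eq_right (by linarith),
        max_eq_left (by linarith)]
      nlinarith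
    · rcases le_total (Z ω) t with h' | h'
      · rw [max_eq_right (by linarith), max_eq_left (by linarith), max_eq_left (by linarith),
          max_eq_right (by linarith)]
        nlinarith
      · rw [max_eq_left (by linarith), max_eq_right (by linarith), max_eq_left (by linarith),
          max_eq_right (by linarith)]
        nlinarith
  rw [integral_add (hi t) (integrable_const _), ← e, ← e] at key
  simp only [integral_const, probReal_univ, one_smul] at key
  have : 0 < min β (1-β) * (t - s) := mul_pos (lt_min h0 (by linarith)) (by linarith)
  linarith

lemma gE_affine (P : Measure Ω) (β : ℝ) (Y : Ω → ℝ) (a b t : ℝ) (hb : 0 ≤ b) :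
    gE P β (fun ω => a + b * Y ω) (a + b * t) = b * gE P β Y t := by
  unfold gE
  have h1 : ∀ ω, max (a + b * Y ω - (a + b * t)) 0 = b * max (Y ω - t) 0 := by
    intro ω
    rw [mul_max_of_nonneg _ _ hb]; congr 1 <;> ring
  have h2 : ∀ ω, max (a + b * t - (a + b * Y ω)) 0 = b * max (t - Y ω) 0 := by
    intro ω
    rw [mul_max_of_nonneg _ _ hb]; congr 1 <;> ring
  simp only [h1, h2, integral_const_mul]
  ring

lemma gE_congr (P : Measure Ω) (β : ℝ) {Z W : Ω → ℝ}
    (h : ProbabilityTheory.IdentDistrib Z W P P) (t : ℝ) : gE P β Z t = gE P β W t := by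
  unfold gE
  have h1 := (h.comp (u := fun x : ℝ => max (x - t) 0) (by fun_prop)).integral_eq
  have h2 := (h.comp (u := fun x : ℝ => max (t - x) 0) (by fun_prop)).integral_eq
  simp only [Function.comp_def] at h1 h2
  rw [h1, h2]

open ProbabilityTheory Matrix in
/-- elliptical portfolio model with covariance-type matrix C: formula for
DQ^ex_α(w ⊙ X) on the simplex in terms of k(w) = (wᵀσ)/√(wᵀCw), and any maximizer of
k over the simplex minimizes DQ^ex_α over the simplex. -/
theorem stmt13
    (P : Measure Ω) [IsProbabilityMeasure P]
    (α : ℝ) (hα : α ∈ Set.Ioo (0:ℝ) (1/2))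
    {n : ℕ} (hn : 1 ≤ n)
    (C : Matrix (Fin n) (Fin n) ℝ) (hC : C.PosSemidef)
    (Delta : Set (Fin n → ℝ))
    (hDelta : Delta = {w | (∀ i, 0 ≤ w i ∧ w i ≤ 1) ∧ ∑ i, w i = 1})
    (hCpos : ∀ w ∈ Delta, 0 < w ⬝ᵥ C.mulVec w)
    (σv : Fin n → ℝ) (hσ : ∀ i, σv i = Real.sqrt (C i i))
    (Y : Ω → ℝ) (hY : Integrable Y P)
    (hYnd : ¬ ∃ c : ℝ, ∀ᵐ ω ∂P, Y ω = c)
    (hEY : ∫ ω, Y ω ∂P = 0)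
    (μv : Fin n → ℝ)
    (X : Fin n → Ω → ℝ) (hX : ∀ i, Integrable (X i) P)
    (hXd : ∀ i, IdentDistrib (X i) (fun ω => μv i + σv i * Y ω) P P)
    (hSd : ∀ w ∈ Delta, IdentDistrib (fun ω => ∑ i, w i * X i ω)
      (fun ω => (∑ i, w i * μv i) + Real.sqrt (w ⬝ᵥ C.mulVec w) * Y ω) P P)
    (ex : ℝ → (Ω → ℝ) → ℝ)
    (hex : ∀ β ∈ Set.Ioo (0:ℝ) 1, ∀ Z : Ω → ℝ, Integrable Z P → IsExpectile P β Z (ex β Z))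
    (k : (Fin n → ℝ) → ℝ)
    (hk : ∀ w, k w = (∑ i, w i * σv i) / Real.sqrt (w ⬝ᵥ C.mulVec w)) :
    (∀ w ∈ Delta, DQex P ex α (fun i ω => w i * X i ω) =
        (∫ ω, max (Y ω - k w * ex α Y) 0 ∂P) /
          (α * ∫ ω, |Y ω - k w * ex α Y| ∂P)) ∧
    (∀ wstar ∈ Delta, (∀ w ∈ Delta, k w ≤ k wstar) →
      ∀ w ∈ Delta, DQex P ex α (fun i ω => wstar i * X i ω)
          ≤ DQex P ex α (fun i ω => w i * X i ω)) := by
  have hα1 : α ∈ Set.Ioo (0:ℝ) 1 := ⟨hα.1, by linarith [hα.2]⟩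
  have hα0 := hα.1
  set e := ex α Y with he
  have hge : gE P α Y e = 0 := (isExp_iff_s13 _ _ _ _).1 (hex α hα1 Y hY)
  -- positivity of the mean absolute deviation
  have habs : ∀ t : ℝ, 0 < ∫ ω, |Y ω - t| ∂P := by
    intro t
    have hi : Integrable (fun ω => |Y ω - t|) P := (hY.sub (integrable_const t)).abs
    refine lt_of_le_of_ne (integral_nonneg fun ω => abs_nonneg _) fun h => hYnd ⟨t, ?_⟩
    have := (integral_eq_zero_iff_of_nonneg (fun ω => abs_nonneg _) hi).1 h.symm
    filter_upwards [this] with ω hω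
    have : |Y ω - t| = 0 := hω
    linarith [abs_eq_zero.1 this]
  have hsplit : ∀ t : ℝ, ∫ ω, |Y ω - t| ∂P
      = ∫ ω, max (Y ω - t) 0 ∂P + ∫ ω, max (t - Y ω) 0 ∂P := by
    intro t
    rw [← integral_add (int_up P hY t) (int_dn P hY t)]
    congr 1
    ext ω
    rcases le_total (Y ω) t with h | h
    · rw [max_eq_right (by linarith), max_eq_left (by linarith), abs_of_nonpos (by linarith)]; ring
    · rw [max_eq_left (by linarith), max_eq_right (by linarith), abs_of_nonneg (by linarith)]; ring
  have hupn : ∀ t : ℝ, 0 ≤ ∫ ω, max (Y ω - t) 0 ∂P :=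
    fun t => integral_nonneg fun ω => le_max_right _ _
  have hdnn : ∀ t : ℝ, 0 ≤ ∫ ω, max (t - Y ω) 0 ∂P :=
    fun t => integral_nonneg fun ω => le_max_right _ _
  have hA : ∀ w ∈ Delta, DQex P ex α (fun i ω => w i * X i ω) =
        (∫ ω, max (Y ω - k w * e) 0 ∂P) / (α * ∫ ω, |Y ω - k w * e| ∂P) := by
    intro w hw
    have hs := Real.sqrt_pos.2 (hCpos w hw)
    have hS := hSd w hw
    have hkw := hk w
    set s := Real.sqrt (w ⬝ᵥ C.mulVec w) with hsdef
    have hw0 : ∀ i, 0 ≤ w i := by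
      rw [hDelta] at hw
      exact fun i => (hw.1 i).1
    have hexi : ∀ i, ex α (fun ω => w i * X i ω) = w i * μv i + (w i * σv i) * e := by
      intro i
      have hint : Integrable (fun ω => w i * X i ω) P := (hX i).const_mul _
      refine (gE_strictAnti P hα1 hint).injective ?_
      rw [(isExp_iff_s13 _ _ _ _).1 (hex α hα1 _ hint)]
      have hid : IdentDistrib (fun ω => w i * X i ω)
          (fun ω => w i * μv i + (w i * σv i) * Y ω) P P := by
        have := (hXd i).comp (u := fun x : ℝ => w i * x) (by fun_prop)
        simp only [Function.comp_def] at this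
        convert this using 2
        ring
      rw [gE_congr P α hid, gE_affine _ _ _ _ _ _ (mul_nonneg (hw0 i) (by rw [hσ]; positivity)),
        hge, mul_zero]
    have hT : ∑ i, ex α (fun ω => w i * X i ω) = ∑ i, w i * μv i + s * (k w * e) := by
      simp only [hexi, Finset.sum_add_distrib, ← Finset.sum_mul]
      rw [hkw]
      field_simp
    set t := k w * e with ht
    have hSint : Integrable (fun ω => ∑ i, w i * X i ω) P :=
      integrable_finsetSum _ fun i _ => (hX i).const_mul _
    have hset : ({β : ℝ | β ∈ Set.Ioo (0:ℝ) 1 ∧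
        ex β (fun ω => ∑ i, w i * X i ω) ≤ ∑ i, ex α (fun ω => w i * X i ω)} ∪ {1})
        = {β : ℝ | β ∈ Set.Ioo (0:ℝ) 1 ∧
          (∫ ω, max (Y ω - t) 0 ∂P) / (∫ ω, |Y ω - t| ∂P) ≤ β} ∪ {1} := by
      congr 1
      ext β
      simp only [Set.mem_setOf_eq]
      refine and_congr_right fun hβ => ?_
      have hanti := gE_strictAnti P hβ hSint
      rw [hT, ← hanti.le_iff_ge, (isExp_iff_s13 _ _ _ _).1 (hex β hβ _ hSint), gE_congr P β hS,
        gE_affine _ _ _ _ _ _ hs.le, div_le_iff₀ (habs t), hsplit t]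
      have h3 : s * gE P β Y t ≤ 0 ↔ gE P β Y t ≤ 0 := by
        constructor
        · intro h; by_contra h'; push Not at h'; nlinarith [mul_pos hs h']
        · intro h; nlinarith
      rw [h3]
      unfold gE
      constructor <;> intro h <;> linarith
    unfold DQex
    rw [hset]
    set r := (∫ ω, max (Y ω - t) 0 ∂P) / (∫ ω, |Y ω - t| ∂P) with hr
    have hr0 : 0 ≤ r := div_nonneg (hupn t) (habs t).le
    have hr1 : r ≤ 1 := by
      rw [hr, div_le_one (habs t), hsplit t]
      linarith [hdnn t]
    have hinf : sInf ({β : ℝ | β ∈ Set.Ioo (0:ℝ) 1 ∧ r ≤ β} ∪ {1}) = r := by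
      refine csInf_eq_of_forall_ge_of_forall_gt_exists_lt ⟨1, Or.inr rfl⟩ ?_ ?_
      · rintro β (h | h)
        · exact h.2
        · rw [h]; exact hr1
      · intro v hv
        rcases hr1.eq_or_lt with h | h
        · exact ⟨1, Or.inr rfl, by linarith⟩
        · obtain ⟨x, hx1, hx2⟩ := exists_between (lt_min hv h)
          rw [lt_min_iff] at hx2
          exact ⟨x, Or.inl ⟨⟨by linarith, hx2.2⟩, hx1.le⟩, hx2.1⟩
    rw [hinf, hr, div_div, mul_comm α]
  refine ⟨hA, ?_⟩
  intro ws hws hmax w hw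
  rw [hA ws hws, hA w hw]
  -- the expectile is nonnegative
  have he0 : 0 ≤ e := by
    rw [← (gE_strictAnti P hα1 hY).le_iff_ge, hge]
    have h0 : ∫ ω, max (Y ω - 0) 0 ∂P - ∫ ω, max (0 - Y ω) 0 ∂P = 0 := by
      rw [← integral_sub (int_up P hY 0) (int_dn P hY 0)]
      refine Eq.trans ?_ hEY
      congr 1
      ext ω
      rcases le_total (Y ω) 0 with h | h
      · rw [max_eq_right (by linarith), max_eq_left (by linarith)]; ring
      · rw [max_eq_left (by linarith), max_eq_right (by linarith)]; ring
    unfold gE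
    nlinarith [hupn 0, hα.2]
  have htt : k w * e ≤ k ws * e := mul_le_mul_of_nonneg_right (hmax w hw) he0
  generalize k w * e = t at *
  generalize k ws * e = t' at *
  have u : ∫ ω, max (Y ω - t') 0 ∂P ≤ ∫ ω, max (Y ω - t) 0 ∂P :=
    integral_mono (int_up P hY _) (int_up P hY _) fun ω => max_le_max (by linarith) le_rfl
  have d : ∫ ω, max (t - Y ω) 0 ∂P ≤ ∫ ω, max (t' - Y ω) 0 ∂P :=
    integral_mono (int_dn P hY _) (int_dn P hY _) fun ω => max_le_max (by linarith) le_rfl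
  rw [div_le_div_iff₀ (mul_pos hα0 (habs _)) (mul_pos hα0 (habs _)), hsplit t, hsplit t']
  have := mul_le_mul u d (hdnn t) (hupn t)
  nlinarith
end

section
/- For every integrable random variable X and every α ∈ (0,1), there exists exactly one real number t satisfying (1−α)·E[(X−t)₊] = α·E[(X−t)₋]; that is, the α-expectile of X is well defined on L¹. -/
open MeasureTheory

variable {Ω : Type*} [MeasurableSpace Ω]

/-- for every integrable X and α ∈ (0,1), there is exactly one t with
(1−α)·E[(X−t)₊] = α·E[(X−t)₋]; i.e. the α-expectile is well defined on L¹. -/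
theorem stmt16
    (P : Measure Ω) [IsProbabilityMeasure P]
    (α : ℝ) (hα : α ∈ Set.Ioo (0:ℝ) 1)
    (X : Ω → ℝ) (hX : Integrable X P) :
    ∃! t : ℝ, IsExpectile P α X t := by
  obtain ⟨h0, h1⟩ := hα
  have iA : ∀ t : ℝ, Integrable (fun ω => max (X ω - t) 0) P := fun t =>
    (hX.sub (integrable_const t)).pos_part
  have iB : ∀ t : ℝ, Integrable (fun ω => max (t - X ω) 0) P := fun t =>
    ((integrable_const t).sub hX).pos_part
  obtain ⟨m, hm0, hm1, hm2⟩ : ∃ m : ℝ, 0 < m ∧ m ≤ α ∧ m ≤ 1 - α :=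
    ⟨min α (1 - α), lt_min h0 (by linarith), min_le_left _ _, min_le_right _ _⟩
  let h : ℝ → ℝ → ℝ := fun x t => (1 - α) * max (x - t) 0 - α * max (t - x) 0
  have ih : ∀ t, Integrable (fun ω => h (X ω) t) P := fun t =>
    ((iA t).const_mul _).sub ((iB t).const_mul _)
  let g : ℝ → ℝ := fun t => ∫ ω, h (X ω) t ∂P
  have hg : ∀ t, g t =
      (1 - α) * ∫ ω, max (X ω - t) 0 ∂P - α * ∫ ω, max (t - X ω) 0 ∂P := by
    intro t
    simp only [g, h]
    rw [integral_sub ((iA t).const_mul _) ((iB t).const_mul _), integral_const_mul,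
      integral_const_mul]
  have hiff : ∀ t, IsExpectile P α X t ↔ g t = 0 := by
    intro t
    rw [hg, sub_eq_zero]
    rfl
  have key : ∀ x s t : ℝ, s ≤ t → m * (t - s) ≤ h x s - h x t ∧ h x s - h x t ≤ t - s := by
    intro x s t hst
    simp only [h]
    rcases le_total x s with a | a
    · rw [max_eq_right (by linarith : x - s ≤ 0), max_eq_left (by linarith : 0 ≤ s - x),
        max_eq_right (by linarith : x - t ≤ 0), max_eq_left (by linarith : 0 ≤ t - x)]
      constructor <;> nlinarith
    · rcases le_total x t with b | b
      · rw [max_eq_left (by linarith : 0 ≤ x - s), max_eq_right (by linarith : s - x ≤ 0),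
          max_eq_right (by linarith : x - t ≤ 0), max_eq_left (by linarith : 0 ≤ t - x)]
        constructor <;> nlinarith
      · rw [max_eq_left (by linarith : 0 ≤ x - s), max_eq_right (by linarith : s - x ≤ 0),
          max_eq_left (by linarith : 0 ≤ x - t), max_eq_right (by linarith : t - x ≤ 0)]
        constructor <;> nlinarith
  have gkey : ∀ s t : ℝ, s ≤ t → m * (t - s) ≤ g s - g t ∧ g s - g t ≤ t - s := by
    intro s t hst
    have e : g s - g t = ∫ ω, (h (X ω) s - h (X ω) t) ∂P :=
      (integral_sub (ih s) (ih t)).symm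
    rw [e]
    have l := integral_mono (integrable_const (μ := P) (m * (t - s))) ((ih s).sub (ih t))
      (fun ω => (key (X ω) s t hst).1)
    have u := integral_mono ((ih s).sub (ih t)) (integrable_const (μ := P) (t - s))
      (fun ω => (key (X ω) s t hst).2)
    simp only [integral_const, probReal_univ, one_smul, Pi.sub_apply] at l u
    exact ⟨l, u⟩
  have gc : Continuous g := by
    have : LipschitzWith 1 g := by
      apply LipschitzWith.of_dist_le_mul
      intro s t
      rw [Real.dist_eq, Real.dist_eq, NNReal.coe_one, one_mul]
      rcases le_total s t with a | a
      · have k := gkey s t a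
        rw [abs_of_nonneg (by nlinarith), abs_of_nonpos (by linarith)]
        linarith
      · have k := gkey t s a
        rw [abs_of_nonpos (by nlinarith), abs_of_nonneg (by linarith)]
        linarith
    exact this.continuous
  have ex : ∃ t, g t = 0 := by
    have hmul : m * (g 0 / m) = g 0 := by field_simp
    rcases le_total 0 (g 0) with a | a
    · have k := (gkey 0 (g 0 / m) (by positivity)).1
      exact mem_range_of_exists_le_of_exists_ge gc ⟨g 0 / m, by linarith⟩ ⟨0, a⟩
    · have k := (gkey (g 0 / m) 0 (div_nonpos_of_nonpos_of_nonneg a hm0.le)).1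
      exact mem_range_of_exists_le_of_exists_ge gc ⟨0, a⟩ ⟨g 0 / m, by linarith⟩
  obtain ⟨t, ht⟩ := ex
  refine ⟨t, (hiff t).2 ht, fun s hs => ?_⟩
  have hs' := (hiff s).1 hs
  rcases lt_trichotomy s t with a | a | a
  · nlinarith [(gkey s t a.le).1]
  · exact a
  · nlinarith [(gkey t s a.le).1]
end

section
/- Let α ∈ (0,1) and let X be an integrable random variable. Then ex_α(X) ≤ 0 if and only if E[(X)₊] ≤ α·E[|X|]. -/
open MeasureTheory

variable {Ω : Type*} [MeasurableSpace Ω]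

/-- ex_α(X) ≤ 0 iff E[(X)₊] ≤ α·E[|X|]. -/
theorem stmt17
    (P : Measure Ω) [IsProbabilityMeasure P]
    (α : ℝ) (hα : α ∈ Set.Ioo (0:ℝ) 1)
    (X : Ω → ℝ) (hX : Integrable X P)
    (t : ℝ) (ht : IsExpectile P α X t) :
    t ≤ 0 ↔ (∫ ω, max (X ω) 0 ∂P) ≤ α * ∫ ω, |X ω| ∂P := by
  obtain ⟨h0, h1⟩ := hα
  unfold IsExpectile at ht
  have i1 : Integrable (fun ω => max (X ω - t) 0) P := (hX.sub (integrable_const t)).pos_part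
  have i2 : Integrable (fun ω => max (t - X ω) 0) P := ((integrable_const t).sub hX).pos_part
  have i3 : Integrable (fun ω => max (X ω) 0) P := hX.pos_part
  have i4 : Integrable (fun ω => |X ω|) P := hX.abs
  have i5 : Integrable (fun ω => (1 - α) * max (X ω - t) 0 - α * max (t - X ω) 0) P :=
    (i1.const_mul _).sub (i2.const_mul _)
  have i6 : Integrable (fun ω => max (X ω) 0 - α * |X ω|) P := i3.sub (i4.const_mul _)
  have e5 : ∫ ω, ((1 - α) * max (X ω - t) 0 - α * max (t - X ω) 0) ∂P = 0 := by
    rw [integral_sub (i1.const_mul _) (i2.const_mul _), integral_const_mul, integral_const_mul, ht,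
      sub_self]
  have e6 : ∫ ω, (max (X ω) 0 - α * |X ω|) ∂P
      = (∫ ω, max (X ω) 0 ∂P) - α * ∫ ω, |X ω| ∂P := by
    rw [integral_sub i3 (i4.const_mul _), integral_const_mul]
  constructor
  · intro h
    have key : ∫ ω, (max (X ω) 0 - α * |X ω|) ∂P
        ≤ ∫ ω, ((1 - α) * max (X ω - t) 0 - α * max (t - X ω) 0) ∂P := by
      refine integral_mono i6 i5 fun ω => ?_
      dsimp only
      rcases max_cases (X ω) 0 with ⟨a, aa⟩ | ⟨a, aa⟩ <;>
      rcases max_cases (X ω - t) 0 with ⟨b, bb⟩ | ⟨b, bb⟩ <;>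
      rcases max_cases (t - X ω) 0 with ⟨c, cc⟩ | ⟨c, cc⟩ <;>
      rcases abs_cases (X ω) with ⟨d, dd⟩ | ⟨d, dd⟩ <;>
      rw [a, b, c, d] <;> nlinarith
    linarith
  · intro h
    by_contra! hpos
    obtain ⟨m, hm, hm1, hm2⟩ : ∃ m : ℝ, 0 < m ∧ m ≤ α ∧ m ≤ 1 - α :=
      ⟨min α (1 - α), lt_min h0 (by linarith), min_le_left _ _, min_le_right _ _⟩
    have key : ∫ ω, (((1 - α) * max (X ω - t) 0 - α * max (t - X ω) 0) + m * t) ∂P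
        ≤ ∫ ω, (max (X ω) 0 - α * |X ω|) ∂P := by
      refine integral_mono (i5.add (integrable_const _)) i6 fun ω => ?_
      dsimp only
      rcases max_cases (X ω) 0 with ⟨a, aa⟩ | ⟨a, aa⟩ <;>
      rcases max_cases (X ω - t) 0 with ⟨b, bb⟩ | ⟨b, bb⟩ <;>
      rcases max_cases (t - X ω) 0 with ⟨c, cc⟩ | ⟨c, cc⟩ <;>
      rcases abs_cases (X ω) with ⟨d, dd⟩ | ⟨d, dd⟩ <;>
      rw [a, b, c, d] <;> nlinarith
    rw [integral_add i5 (integrable_const _), e5, e6] at key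
    simp at key
    have := mul_pos hm hpos
    linarith
end

section
/- Let p ∈ (0,1) and let X₁, X₂ be independent random variables, each Bernoulli(p) (P(Xᵢ = 1) = p, P(Xᵢ = 0) = 1 − p). Then for every β ∈ (0,1): if β ≤ p²/(1 − 2p + 2p²), then ex_β(X₁ + X₂) = (2pβ + 2p² − 4βp²) / (p² − 2βp² + β); and if β > p²/(1 − 2p + 2p²), then ex_β(X₁ + X₂) = (2p − 2βp) / (2p − p² − 4βp + 2p²β + β). -/
open MeasureTheory

variable {Ω : Type*} [MeasurableSpace Ω]

lemma ae01 (P : Measure Ω) [IsProbabilityMeasure P]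
    (p : ℝ) (hp : p ∈ Set.Ioo (0:ℝ) 1) (X : Ω → ℝ) (hm : Measurable X)
    (h1 : P {ω | X ω = 1} = ENNReal.ofReal p)
    (h0 : P {ω | X ω = 0} = ENNReal.ofReal (1 - p)) :
    ∀ᵐ ω ∂P, X ω = 0 ∨ X ω = 1 := by
  have m0 : MeasurableSet {ω | X ω = 0} := hm (measurableSet_singleton 0)
  have m1 : MeasurableSet {ω | X ω = 1} := hm (measurableSet_singleton 1)
  have hd : Disjoint {ω | X ω = 0} {ω | X ω = 1} := by
    rw [Set.disjoint_left]
    intro ω h h'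
    simp only [Set.mem_ofPred_eq] at h h'
    linarith
  have hu : P ({ω | X ω = 0} ∪ {ω | X ω = 1}) = 1 := by
    rw [measure_union hd m1, h0, h1, ← ENNReal.ofReal_add (by linarith [hp.2]) hp.1.le]
    simp
  have := (prob_compl_eq_zero_iff (μ := P) (m0.union m1)).2 hu
  rw [ae_iff]
  convert this using 2
  ext ω
  simp

lemma expect_sum (P : Measure Ω) [IsProbabilityMeasure P]
    (p : ℝ) (hp : p ∈ Set.Ioo (0:ℝ) 1)
    (X₁ X₂ : Ω → ℝ) (hmeas₁ : Measurable X₁) (hmeas₂ : Measurable X₂)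
    (hindep : ProbabilityTheory.IndepFun X₁ X₂ P)
    (h1₁ : P {ω | X₁ ω = 1} = ENNReal.ofReal p)
    (h0₁ : P {ω | X₁ ω = 0} = ENNReal.ofReal (1 - p))
    (h1₂ : P {ω | X₂ ω = 1} = ENNReal.ofReal p)
    (h0₂ : P {ω | X₂ ω = 0} = ENNReal.ofReal (1 - p)) (f : ℝ → ℝ) :
    ∫ ω, f (X₁ ω + X₂ ω) ∂P = (1 - p) ^ 2 * f 0 + 2 * p * (1 - p) * f 1 + p ^ 2 * f 2 := by
  set A := {ω | X₁ ω = 1} with hA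
  set B := {ω | X₂ ω = 1} with hB
  have mA : MeasurableSet A := hmeas₁ (measurableSet_singleton 1)
  have mB : MeasurableSet B := hmeas₂ (measurableSet_singleton 1)
  have hAB : P (A ∩ B) = P A * P B :=
    hindep.measure_inter_preimage_eq_mul {1} {1} (measurableSet_singleton 1)
      (measurableSet_singleton 1)
  have rA : P.real A = p := by simp [Measure.real, h1₁, hp.1.le]
  have rB : P.real B = p := by simp [Measure.real, h1₂, hp.1.le]
  have rAB : P.real (A ∩ B) = p * p := by
    simp [Measure.real, hAB, h1₁, h1₂, hp.1.le]
  have hae : (fun ω => f (X₁ ω + X₂ ω)) =ᵐ[P] fun ω =>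
      f 0 + A.indicator (fun _ => f 1 - f 0) ω + B.indicator (fun _ => f 1 - f 0) ω
        + (A ∩ B).indicator (fun _ => f 2 - 2 * f 1 + f 0) ω := by
    filter_upwards [ae01 P p hp X₁ hmeas₁ h1₁ h0₁, ae01 P p hp X₂ hmeas₂ h1₂ h0₂] with ω h h'
    have e : (1:ℝ) + 1 = 2 := by norm_num
    rcases h with h | h <;> rcases h' with h' | h' <;>
      simp [Set.indicator, hA, hB, h, h', e]
    ring
  have iA : Integrable (A.indicator (fun _ => f 1 - f 0)) P := (integrable_const _).indicator mA
  have iB : Integrable (B.indicator (fun _ => f 1 - f 0)) P := (integrable_const _).indicator mB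
  have iAB : Integrable ((A ∩ B).indicator (fun _ => f 2 - 2 * f 1 + f 0)) P :=
    (integrable_const _).indicator (mA.inter mB)
  have i1 : Integrable (fun ω => f 0 + A.indicator (fun _ => f 1 - f 0) ω) P :=
    (integrable_const _).add iA
  have i2 : Integrable (fun ω => f 0 + A.indicator (fun _ => f 1 - f 0) ω
      + B.indicator (fun _ => f 1 - f 0) ω) P := i1.add iB
  rw [integral_congr_ae hae, integral_add i2 iAB, integral_add i1 iB, integral_add (integrable_const _) iA,
    integral_indicator_const _ mA, integral_indicator_const _ mB,
    integral_indicator_const _ (mA.inter mB), rA, rB, rAB]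
  simp
  ring

/-- the β-expectile of the sum of two independent Bernoulli(p) random
variables, with the two regimes split at β = p²/(1 − 2p + 2p²). -/
theorem stmt19
    (P : Measure Ω) [IsProbabilityMeasure P]
    (p : ℝ) (hp : p ∈ Set.Ioo (0:ℝ) 1)
    (X₁ X₂ : Ω → ℝ) (hmeas₁ : Measurable X₁) (hmeas₂ : Measurable X₂)
    (hindep : ProbabilityTheory.IndepFun X₁ X₂ P)
    (h1₁ : P {ω | X₁ ω = 1} = ENNReal.ofReal p)
    (h0₁ : P {ω | X₁ ω = 0} = ENNReal.ofReal (1 - p))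
    (h1₂ : P {ω | X₂ ω = 1} = ENNReal.ofReal p)
    (h0₂ : P {ω | X₂ ω = 0} = ENNReal.ofReal (1 - p))
    (β : ℝ) (hβ : β ∈ Set.Ioo (0:ℝ) 1) :
    (β ≤ p ^ 2 / (1 - 2 * p + 2 * p ^ 2) →
      ∀ t : ℝ, IsExpectile P β (fun ω => X₁ ω + X₂ ω) t ↔
        t = (2 * p * β + 2 * p ^ 2 - 4 * β * p ^ 2) / (p ^ 2 - 2 * β * p ^ 2 + β)) ∧
    (p ^ 2 / (1 - 2 * p + 2 * p ^ 2) < β →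
      ∀ t : ℝ, IsExpectile P β (fun ω => X₁ ω + X₂ ω) t ↔
        t = (2 * p - 2 * β * p) / (2 * p - p ^ 2 - 4 * β * p + 2 * p ^ 2 * β + β)) := by
  obtain ⟨hp0, hp1⟩ := hp
  obtain ⟨hb0, hb1⟩ := hβ
  have key : ∀ t : ℝ, IsExpectile P β (fun ω => X₁ ω + X₂ ω) t ↔
      (1 - β) * ((1 - p) ^ 2 * max (0 - t) 0 + 2 * p * (1 - p) * max (1 - t) 0
        + p ^ 2 * max (2 - t) 0) =
      β * ((1 - p) ^ 2 * max (t - 0) 0 + 2 * p * (1 - p) * max (t - 1) 0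
        + p ^ 2 * max (t - 2) 0) := by
    intro t
    have E := expect_sum P p ⟨hp0, hp1⟩ X₁ X₂ hmeas₁ hmeas₂ hindep h1₁ h0₁ h1₂ h0₂
    unfold IsExpectile
    rw [E (fun x => max (x - t) 0), E (fun x => max (t - x) 0)]
  have hc : 0 < 1 - 2 * p + 2 * p ^ 2 := by nlinarith [sq_nonneg (1 - 2 * p)]
  have q0 : 0 < 1 - p := by linarith
  have b0 : 0 < 1 - β := by linarith
  have a1 : 0 < (1 - p) ^ 2 := by positivity
  have a2 : 0 < 2 * p * (1 - p) := by positivity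
  have a3 : 0 < p ^ 2 := by positivity
  -- uniqueness
  have mono : ∀ s t : ℝ, s < t → 
      IsExpectile P β (fun ω => X₁ ω + X₂ ω) s →
      IsExpectile P β (fun ω => X₁ ω + X₂ ω) t → False := by
    intro s t hst hs ht
    rw [key] at hs ht
    have g : ∀ c : ℝ, (1 - β) * max (c - t) 0 - β * max (t - c) 0 <
        (1 - β) * max (c - s) 0 - β * max (s - c) 0 := by
      intro c
      rcases le_total c s with h | h <;> rcases le_total c t with h' | h' 
      · rw [max_eq_right (by linarith), max_eq_left (by linarith), max_eq_right (by linarith),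
          max_eq_left (by linarith)]
        nlinarith
      · linarith
      · rw [max_eq_right (by linarith), max_eq_left (by linarith), max_eq_left (by linarith),
          max_eq_right (by linarith)]
        rcases eq_or_lt_of_le h with e | e
        · subst e; nlinarith
        · nlinarith [mul_pos b0 (sub_pos.2 e), mul_nonneg hb0.le (sub_nonneg.2 h')]
      · rw [max_eq_left (by linarith), max_eq_right (by linarith), max_eq_left (by linarith),
          max_eq_right (by linarith)]
        nlinarith
    have := mul_lt_mul_of_pos_left (g 0) a1
    have := mul_lt_mul_of_pos_left (g 1) a2
    have := mul_lt_mul_of_pos_left (g 2) a3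
    linarith
  have fin : ∀ t₀ : ℝ, IsExpectile P β (fun ω => X₁ ω + X₂ ω) t₀ →
      ∀ t, IsExpectile P β (fun ω => X₁ ω + X₂ ω) t ↔ t = t₀ := by
    intro t₀ h0 t
    refine ⟨fun h => ?_, fun h => h ▸ h0⟩
    rcases lt_trichotomy t t₀ with h' | h' | h'
    · exact (mono _ _ h' h h0).elim
    · exact h'
    · exact (mono _ _ h' h0 h).elim
  constructor
  · intro hle
    rw [le_div_iff₀ hc] at hle
    apply fin
    have hd : 0 < p ^ 2 - 2 * β * p ^ 2 + β := by
      have : 0 < (1 - β) * p ^ 2 + β * ((1 - p) ^ 2 + 2 * p * (1 - p)) := by positivity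
      linarith
    set t := (2 * p * β + 2 * p ^ 2 - 4 * β * p ^ 2) / (p ^ 2 - 2 * β * p ^ 2 + β) with ht
    have ht1 : 1 ≤ t := by rw [ht, le_div_iff₀ hd]; linarith
    have ht2 : t ≤ 2 := by
      rw [ht, div_le_iff₀ hd]; nlinarith [mul_pos hb0 q0]
    have hm : t * (p ^ 2 - 2 * β * p ^ 2 + β) = 2 * p * β + 2 * p ^ 2 - 4 * β * p ^ 2 :=
      div_mul_cancel₀ _ hd.ne'
    rw [key, max_eq_right (a := 0 - t) (by linarith), max_eq_right (a := 1 - t) (by linarith),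
      max_eq_left (a := 2 - t) (by linarith), max_eq_left (a := t - 0) (by linarith),
      max_eq_left (a := t - 1) (by linarith), max_eq_right (a := t - 2) (by linarith)]
    linear_combination -hm
  · intro hlt
    rw [div_lt_iff₀ hc] at hlt
    apply fin
    have hd : 0 < 2 * p - p ^ 2 - 4 * β * p + 2 * p ^ 2 * β + β := by
      have : 0 < β * (1 - p) ^ 2 + (1 - β) * (p ^ 2 + 2 * p * (1 - p)) := by positivity
      linarith
    set t := (2 * p - 2 * β * p) / (2 * p - p ^ 2 - 4 * β * p + 2 * p ^ 2 * β + β) with ht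
    have ht1 : t ≤ 1 := by rw [ht, div_le_iff₀ hd]; linarith
    have ht0 : 0 ≤ t := by
      apply div_nonneg _ hd.le
      nlinarith [mul_pos hp0 b0]
    have hm : t * (2 * p - p ^ 2 - 4 * β * p + 2 * p ^ 2 * β + β) = 2 * p - 2 * β * p :=
      div_mul_cancel₀ _ hd.ne'
    rw [key, max_eq_right (a := 0 - t) (by linarith), max_eq_left (a := 1 - t) (by linarith),
      max_eq_left (a := 2 - t) (by linarith), max_eq_left (a := t - 0) (by linarith),
      max_eq_right (a := t - 1) (by linarith), max_eq_right (a := t - 2) (by linarith)]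
    linear_combination -hm
end
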